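/- Let M be a right R-module and let s, g be natural numbers such that R satisfies the stable range condition (S_s) and R^g is a direct summand of M. Then the poset O(M) ∩ U(M^∞), of sequences with entries in M ⊆ M^∞ that are unimodular in M^∞, is (g − s − 1)-connected. -/

import Mathlib

open CategoryTheory MulOpposite

/-- `O(V)`: the poset of ordered sequences of distinct elements of `V`, of length at least
one, ordered by refinement (i.e. by the sublist relation). -/
def OSeq (V : Type u) : Type u := {l : List V // l ≠ [] ∧ l.Nodup}

instance (V : Type u) : PartialOrder (OSeq V) where
  le a b := a.1.Sublist b.1
  le_refl a := List.Sublist.refl a.1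
  le_trans a b c hab hbc := List.Sublist.trans hab hbc
  le_antisymm a b h h' := Subtype.ext (List.Sublist.antisymm h h')

/-- A space is `d`-connected (for an integer `d`) if it is nonempty and all its homotopy
groups in degrees `≤ d` vanish; for `d ≤ -2` the condition is vacuous. -/
def TopDConnected (X : Type*) [TopologicalSpace X] (d : ℤ) : Prop :=
  d ≤ -2 ∨
    (Nonempty X ∧ ∀ (n : ℕ), (n : ℤ) ≤ d → ∀ x : X, Subsingleton (HomotopyGroup (Fin n) X x))

/-- A poset is `d`-connected if the geometric realization of its order complex (nerve) is. -/
def PosetDConnected (P : Type) [PartialOrder P] (d : ℤ) : Prop :=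
  TopDConnected (SSet.toTop.obj (nerve P)) d

/-- A set of sequences is `d`-connected if it is so as a subposet of `O(V)`. -/
def SetDConnected {V : Type} (F : Set (OSeq V)) (d : ℤ) : Prop :=
  PosetDConnected F d

/-- `F ⊆ O(V)` satisfies the chain condition: it is downwards closed for refinement. -/
def ChainCondition {V : Type u} (F : Set (OSeq V)) : Prop :=
  ∀ ⦃w v : OSeq V⦄, w ≤ v → v ∈ F → w ∈ F

/-- `F_v`: the subposet of sequences `w ∈ F` whose concatenation with `v` again lies in `F`. -/
def SeqExt {V : Type u} (F : Set (OSeq V)) (v : OSeq V) : Set (OSeq V) :=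
  {w | w ∈ F ∧ ∃ h : w.1 ++ v.1 ≠ [] ∧ (w.1 ++ v.1).Nodup, (⟨w.1 ++ v.1, h⟩ : OSeq V) ∈ F}

/-- `O(X)` inside `O(V)`: sequences all of whose entries lie in `X`. -/
def SeqIn {V : Type u} (X : Set V) : Set (OSeq V) :=
  {w | ∀ x ∈ w.1, x ∈ X}

/-- A sequence `v` in a right `R`-module `M` (viewed as a left `Rᵐᵒᵖ`-module) is unimodular. -/
def IsUnimodularSeq (R : Type*) [Ring R] (M : Type*) [AddCommGroup M] [Module Rᵐᵒᵖ M]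
    {n : ℕ} (v : Fin n → M) : Prop :=
  ∃ (f : Fin n → (R →ₗ[Rᵐᵒᵖ] M)) (φ : Fin n → (M →ₗ[Rᵐᵒᵖ] R)),
    (∀ i, f i 1 = v i) ∧ ∀ i j, (φ j).comp (f i) = if i = j then LinearMap.id else 0

/-- `M^∞ := M ⊕ R^∞`, where `R^∞` is free with basis `e_1, e_2, …`. -/
abbrev MInf (R : Type u) [Ring R] (M : Type u) [AddCommGroup M] [Module Rᵐᵒᵖ M] : Type u :=
  M × (ℕ →₀ R)

/-- `U(W)`: the subposet of `O(W)` consisting of unimodular sequences in the module `W`. -/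
def UnimodSeqs (R : Type*) [Ring R] (W : Type*) [AddCommGroup W] [Module Rᵐᵒᵖ W] :
    Set (OSeq W) :=
  {w | IsUnimodularSeq R W (fun i : Fin w.1.length => w.1.get i)}

/-- `R` satisfies the stable range condition `(S_s)`. -/
def SatisfiesStableRange (R : Type*) [Ring R] (s : ℕ) : Prop :=
  ∀ r : Fin (s + 1) → R,
    IsUnimodularSeq R (Fin (s + 1) → R) (fun _ : Fin 1 => r) →
      ∃ t : Fin s → R,
        IsUnimodularSeq R (Fin s → R)
          (fun _ : Fin 1 => fun i => r i.castSucc + t i * r (Fin.last s))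

/-- `S` fills `n`-spheres: each continuous map from the boundary of the `n`-cube `[-1, 1]^n`
to `S` extends to a continuous map from the cube to `S`. -/
def FillsSphere (n : ℕ) {Y : Type*} [TopologicalSpace Y] (S : Set Y) : Prop :=
  ∀ f : (Fin n → ℝ) → Y, ContinuousOn f (Metric.sphere 0 1) →
    Set.MapsTo f (Metric.sphere 0 1) S →
    ∃ g : (Fin n → ℝ) → Y, ContinuousOn g (Metric.closedBall 0 1) ∧
      Set.MapsTo g (Metric.closedBall 0 1) S ∧ Set.EqOn g f (Metric.sphere 0 1)

section Carrier

variable {E Y ι : Type*} [TopologicalSpace E] [TopologicalSpace Y]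

/-- A closed cell of dimension `n` with boundary `b`: the pair `(s, b)` is parametrized by the
cube and its boundary. -/
def IsCubeCell (n : ℕ) (s b : Set E) : Prop :=
  ∃ (e : (Fin n → ℝ) → E) (e' : E → (Fin n → ℝ)), Continuous e ∧ Continuous e' ∧
    (∀ y, e' (e y) = y) ∧ Set.MapsTo e (Metric.sphere 0 1) b ∧
    Set.MapsTo e' s (Metric.closedBall 0 1) ∧ Set.MapsTo e' b (Metric.sphere 0 1) ∧
    ∀ x ∈ s, e (e' x) = x

theorem IsCubeCell.exists_extension {n : ℕ} {s b : Set E} (h : IsCubeCell n s b) (hbs : b ⊆ s)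
    {S : Set Y} (hS : FillsSphere n S) {f : E → Y} (hf : ContinuousOn f b)
    (hfS : Set.MapsTo f b S) :
    ∃ g : E → Y, ContinuousOn g s ∧ Set.MapsTo g s S ∧ Set.EqOn g f b := by
  obtain ⟨e, e', he, he', hee, heb, hes, heb', hinv⟩ := h
  obtain ⟨g, hg, hgS, hgf⟩ := hS (f ∘ e) (hf.comp he.continuousOn heb) (hfS.comp heb)
  refine ⟨g ∘ e', hg.comp he'.continuousOn hes, hgS.comp hes, fun x hx => ?_⟩
  simp only [Function.comp_apply, hgf (heb' hx), hinv x (hbs hx)]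

/-- Extension of maps carried by a carrier on a finite cell complex. -/
theorem exists_carried_extension [Finite ι] (cell bd : ι → Set E) (dim : ι → ℕ)
    (hcl : ∀ c, IsClosed (cell c)) (hbs : ∀ c, bd c ⊆ cell c)
    (hcube : ∀ c, IsCubeCell (dim c) (cell c) (bd c)) (L : Set ι) (Φ : ι → Set Y)
    (hbd : ∀ c, c ∉ L → ∀ x ∈ bd c, ∃ c', dim c' < dim c ∧ x ∈ cell c' ∧ Φ c' ⊆ Φ c)
    (hint : ∀ c, c ∉ L → ∀ c', (c' ∈ L ∨ dim c' ≤ dim c) → c' ≠ c → cell c ∩ cell c' ⊆ bd c)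
    (f : E → Y) (hf : ContinuousOn f (⋃ c ∈ L, cell c))
    (hfΦ : ∀ c ∈ L, Set.MapsTo f (cell c) (Φ c))
    (hΦ : ∀ c, c ∉ L → FillsSphere (dim c) (Φ c)) :
    ∃ g : E → Y, ContinuousOn g (⋃ c, cell c) ∧ (∀ c, Set.MapsTo g (cell c) (Φ c)) ∧
      Set.EqOn g f (⋃ c ∈ L, cell c) := by
  classical
  have key : ∀ n : ℕ, ∃ g : E → Y, (∀ c, (c ∈ L ∨ dim c < n) → ContinuousOn g (cell c)) ∧
      (∀ c, (c ∈ L ∨ dim c < n) → Set.MapsTo g (cell c) (Φ c)) ∧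
      Set.EqOn g f (⋃ c ∈ L, cell c) := by
    intro n
    induction n with
    | zero =>
      refine ⟨f, fun c hc => ?_, fun c hc => ?_, fun x _ => rfl⟩
      · have hc : c ∈ L := by simpa using hc
        exact hf.mono (Set.subset_biUnion_of_mem hc)
      · exact hfΦ c (by simpa using hc)
    | succ n ih =>
      obtain ⟨g, hg, hgΦ, hgf⟩ := ih
      have hex : ∀ c, c ∉ L ∧ dim c = n → ∃ k : E → Y, ContinuousOn k (cell c) ∧
          Set.MapsTo k (cell c) (Φ c) ∧ Set.EqOn k g (bd c) := by
        rintro c ⟨hcL, rfl⟩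
        refine (hcube c).exists_extension (hbs c) (hΦ c hcL) ?_ ?_
        · have : ContinuousOn g (⋃ c' : {c' // dim c' < dim c}, cell c') :=
            LocallyFinite.continuousOn_iUnion (locallyFinite_of_finite _) (fun c' => hcl _)
              (fun c' => hg _ (Or.inr c'.2))
          refine this.mono fun x hx => ?_
          obtain ⟨c', hc', hxc', -⟩ := hbd c hcL x hx
          exact Set.mem_iUnion.2 ⟨⟨c', hc'⟩, hxc'⟩
        · intro x hx
          obtain ⟨c', hc', hxc', hsub⟩ := hbd c hcL x hx
          exact hsub (hgΦ c' (Or.inr hc') hxc')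
      have : Nonempty (E → Y) := ⟨f⟩
      choose! k hk hkΦ hkg using hex
      let old : Set E := ⋃ c ∈ {c | c ∈ L ∨ dim c < n}, cell c
      let pick : E → Prop := fun x => ∃ c, (c ∉ L ∧ dim c = n) ∧ x ∈ cell c
      let g' : E → Y := fun x =>
        if x ∈ old then g x else if h : pick x then k h.choose x else g x
      have hold : ∀ c, (c ∈ L ∨ dim c < n) → Set.EqOn g' g (cell c) := by
        intro c hc x hx
        exact if_pos (Set.mem_biUnion (show c ∈ {c | c ∈ L ∨ dim c < n} from hc) hx)
      have hnew : ∀ c, (c ∉ L ∧ dim c = n) → Set.EqOn g' (k c) (cell c) := by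
        intro c hc x hx
        by_cases hxo : x ∈ old
        · have : g' x = g x := if_pos hxo
          rw [this]
          obtain ⟨c', hc', hxc'⟩ := Set.mem_iUnion₂.1 hxo
          refine (hkg c hc (hint c hc.1 c' ?_ ?_ ⟨hx, hxc'⟩)).symm
          · rcases hc' with h | h
            · exact Or.inl h
            · exact Or.inr (by omega)
          · rintro rfl
            rcases hc' with h | h
            · exact hc.1 h
            · omega
        · have hp : pick x := ⟨c, hc, hx⟩
          have : g' x = k hp.choose x := by
            simp only [g', if_neg hxo, dif_pos hp]
          rw [this]
          obtain ⟨h1, h2⟩ := hp.choose_spec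
          by_cases hcc : hp.choose = c
          · rw [hcc]
          · have hb : x ∈ bd c := hint c hc.1 _ (Or.inr (by omega)) hcc ⟨hx, h2⟩
            obtain ⟨c', hc', hxc', -⟩ := hbd c hc.1 x hb
            exact absurd (Set.mem_biUnion
              (show c' ∈ {c | c ∈ L ∨ dim c < n} from Or.inr (by omega)) hxc') hxo
      have split : ∀ c, (c ∈ L ∨ dim c < n + 1) → (c ∈ L ∨ dim c < n) ∨ (c ∉ L ∧ dim c = n) := by
        intro c hc
        by_cases hL : c ∈ L
        · exact Or.inl (Or.inl hL)
        · rcases hc with h | h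
          · exact absurd h hL
          · by_cases hn : dim c = n
            · exact Or.inr ⟨hL, hn⟩
            · exact Or.inl (Or.inr (by omega))
      refine ⟨g', fun c hc => ?_, fun c hc => ?_, fun x hx => ?_⟩
      · rcases split c hc with h | h
        · exact (hg c h).congr (hold c h)
        · exact (hk c h).congr (hnew c h)
      · rcases split c hc with h | h
        · exact (hgΦ c h).congr (hold c h).symm
        · exact (hkΦ c h).congr (hnew c h).symm
      · obtain ⟨c, hc, hxc⟩ := Set.mem_iUnion₂.1 hx
        rw [hold c (Or.inl hc) hxc, hgf hx]
  obtain ⟨N, hN⟩ : ∃ N, ∀ c, dim c < N := by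
    obtain ⟨M, hM⟩ := (Set.finite_range dim).bddAbove
    exact ⟨M + 1, fun c => Nat.lt_succ_of_le (hM ⟨c, rfl⟩)⟩
  obtain ⟨g, hg, hgΦ, hgf⟩ := key N
  exact ⟨g, LocallyFinite.continuousOn_iUnion (locallyFinite_of_finite _) hcl
    (fun c => hg c (Or.inr (hN c))), fun c => hgΦ c (Or.inr (hN c)), hgf⟩

end Carrier

section Grid

variable {κ : Type*}

/-- Cells of the integral cubical grid: an even coordinate `2 a` stands for the point `a`, an odd
coordinate `2 a + 1` for the interval `[a, a + 1]`. -/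
def gridCell (z : κ → ℤ) : Set (κ → ℝ) :=
  {x | ∀ i, ((z i / 2 : ℤ) : ℝ) ≤ x i ∧ x i ≤ (((z i + 1) / 2 : ℤ) : ℝ)}

/-- The boundary of a cell of the grid. -/
def gridBoundary (z : κ → ℤ) : Set (κ → ℝ) :=
  {x | x ∈ gridCell z ∧
    ∃ i, Odd (z i) ∧ (x i = ((z i / 2 : ℤ) : ℝ) ∨ x i = (((z i + 1) / 2 : ℤ) : ℝ))}

/-- The dimension of a cell of the grid. -/
noncomputable def gridDim [Fintype κ] (z : κ → ℤ) : ℕ := Fintype.card {i // Odd (z i)}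

/-- The face relation between cells of the grid. -/
def IsGridFace (z' z : κ → ℤ) : Prop :=
  ∀ i, z' i = z i ∨ (Odd (z i) ∧ (z' i = z i + 1 ∨ z' i = z i - 1))

theorem isClosed_gridCell (z : κ → ℤ) : IsClosed (gridCell z) := by
  have : gridCell z = Set.Icc (fun i => ((z i / 2 : ℤ) : ℝ))
      (fun i => (((z i + 1) / 2 : ℤ) : ℝ)) := by
    ext x
    simp [gridCell, Set.mem_Icc, Pi.le_def, forall_and]
  rw [this]
  exact isClosed_Icc

theorem int_half_bounds (a : ℤ) : (Odd a ∧ ((a / 2 : ℤ) : ℝ) = a / 2 - 1 / 2 ∧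
      (((a + 1) / 2 : ℤ) : ℝ) = a / 2 + 1 / 2) ∨
    (Even a ∧ ((a / 2 : ℤ) : ℝ) = a / 2 ∧ (((a + 1) / 2 : ℤ) : ℝ) = a / 2) := by
  rcases Int.even_or_odd a with h | h
  · right
    obtain ⟨b, rfl⟩ := h
    have h1 : (b + b) / 2 = b := by omega
    have h2 : (b + b + 1) / 2 = b := by omega
    refine ⟨⟨b, rfl⟩, ?_, ?_⟩ <;> simp only [h1, h2] <;> push_cast <;> ring
  · left
    obtain ⟨b, rfl⟩ := h
    have h1 : (2 * b + 1) / 2 = b := by omega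
    have h2 : (2 * b + 1 + 1) / 2 = b + 1 := by omega
    refine ⟨⟨b, rfl⟩, ?_, ?_⟩ <;> simp only [h1, h2] <;> push_cast <;> ring

theorem isCubeCell_gridCell [Fintype κ] (z : κ → ℤ) :
    IsCubeCell (gridDim z) (gridCell z) (gridBoundary z) := by
  classical
  let ε : {i // Odd (z i)} ≃ Fin (gridDim z) := Fintype.equivFin _
  refine ⟨fun y i => (z i : ℝ) / 2 + if h : Odd (z i) then y (ε ⟨i, h⟩) / 2 else 0,
    fun x j => 2 * (x (ε.symm j) - (z (ε.symm j) : ℝ) / 2), ?_, ?_, ?_, ?_, ?_, ?_, ?_⟩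
  · refine continuous_pi fun i => ?_
    by_cases h : Odd (z i)
    · simp only [h, dif_pos]; fun_prop
    · simp only [h, dif_neg, not_false_eq_true]; fun_prop
  · fun_prop
  · intro y
    ext j
    have := (ε.symm j).2
    simp only [this, dif_pos, Subtype.coe_eta, Equiv.apply_symm_apply]
    ring
  · intro y hy
    have hy' : ‖y‖ = 1 := by simpa using hy
    have hle : ∀ j, |y j| ≤ 1 := fun j => by
      have := norm_le_pi_norm y j
      rwa [hy', Real.norm_eq_abs] at this
    obtain ⟨j, hj⟩ : ∃ j, |y j| = 1 := by
      by_contra! hne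
      have : ‖y‖ < 1 := (pi_norm_lt_iff one_pos).2 fun j => by
        rw [Real.norm_eq_abs]; exact lt_of_le_of_ne (hle j) (hne j)
      linarith
    refine ⟨fun i => ?_, ε.symm j, (ε.symm j).2, ?_⟩
    · rcases int_half_bounds (z i) with ⟨ho, h1, h2⟩ | ⟨he, h1, h2⟩
      · have := abs_le.1 (hle (ε ⟨i, ho⟩))
        simp only [ho, dif_pos, h1, h2]
        constructor <;> linarith
      · have : ¬ Odd (z i) := by simpa using he
        simp [this, h1, h2]
    · rcases int_half_bounds (z (ε.symm j)) with ⟨ho, h1, h2⟩ | ⟨he, h1, h2⟩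
      · simp only [ho, dif_pos, h1, h2, Subtype.coe_eta, Equiv.apply_symm_apply]
        rcases (abs_eq zero_le_one).1 hj with h | h
        · right; rw [h]
        · left; rw [h]; ring
      · exact absurd (ε.symm j).2 (by simpa using he)
  · intro x hx
    rw [mem_closedBall_zero_iff, pi_norm_le_iff_of_nonneg zero_le_one]
    intro j
    have hx := hx (ε.symm j)
    rw [Real.norm_eq_abs, abs_le]
    rcases int_half_bounds (z (ε.symm j)) with ⟨ho, h1, h2⟩ | ⟨he, h1, h2⟩ <;>
      rw [h1, h2] at hx <;> constructor <;> linarith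
  · rintro x ⟨hx, i, hi, hxi⟩
    rw [mem_sphere_zero_iff_norm]
    refine le_antisymm ?_ ?_
    · rw [pi_norm_le_iff_of_nonneg zero_le_one]
      intro j
      have hx := hx (ε.symm j)
      rw [Real.norm_eq_abs, abs_le]
      rcases int_half_bounds (z (ε.symm j)) with ⟨ho, h1, h2⟩ | ⟨he, h1, h2⟩ <;>
        rw [h1, h2] at hx <;> constructor <;> linarith
    · refine le_trans ?_ (norm_le_pi_norm _ (ε ⟨i, hi⟩))
      rcases int_half_bounds (z i) with ⟨ho, h1, h2⟩ | ⟨he, h1, h2⟩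
      · rw [h1, h2] at hxi
        simp only [Real.norm_eq_abs, Equiv.symm_apply_apply]
        rcases hxi with h | h <;> rw [h]
        · rw [show (2 : ℝ) * ((z i : ℝ) / 2 - 1 / 2 - (z i : ℝ) / 2) = -1 by ring]; simp
        · rw [show (2 : ℝ) * ((z i : ℝ) / 2 + 1 / 2 - (z i : ℝ) / 2) = 1 by ring]; simp
      · exact absurd hi (by simpa using he)
  · intro x hx
    ext i
    by_cases h : Odd (z i)
    · simp [h]
    · rcases int_half_bounds (z i) with ⟨ho, h1, h2⟩ | ⟨he, h1, h2⟩
      · exact absurd ho h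
      · have hx := hx i
        rw [h1, h2] at hx
        simp only [h, dif_neg, not_false_eq_true]
        linarith

theorem exists_face_of_mem_gridBoundary [Fintype κ] {z : κ → ℤ} {x : κ → ℝ}
    (hx : x ∈ gridBoundary z) :
    ∃ z', gridDim z' < gridDim z ∧ x ∈ gridCell z' ∧ IsGridFace z' z := by
  classical
  obtain ⟨hx, i, hi, hxi⟩ := hx
  obtain ⟨a, ha, hxa⟩ : ∃ a : ℤ, (2 * a = z i + 1 ∨ 2 * a = z i - 1) ∧ x i = a := by
    obtain ⟨b, hb⟩ := hi
    rcases hxi with h | h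
    · exact ⟨z i / 2, Or.inr (by omega), h⟩
    · exact ⟨(z i + 1) / 2, Or.inl (by omega), h⟩
  refine ⟨Function.update z i (2 * a), ?_, fun j => ?_, fun j => ?_⟩
  · refine Fintype.card_lt_of_injective_of_notMem
      (fun j => ⟨j.1, ?_⟩) (b := ⟨i, hi⟩) ?_ ?_
    · have hj := j.2
      by_cases hji : j.1 = i
      · rw [hji, Function.update_self] at hj
        exact absurd hj (by simp)
      · rwa [Function.update_of_ne hji] at hj
    · intro j k hjk
      simpa [Subtype.ext_iff] using hjk
    · rintro ⟨j, hj⟩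
      have hj2 := j.2
      have hji : j.1 = i := by simpa [Subtype.ext_iff] using hj
      rw [hji, Function.update_self] at hj2
      exact absurd hj2 (by simp)
  · by_cases hji : j = i
    · subst hji
      rw [Function.update_self]
      have h1 : 2 * a / 2 = a := by omega
      have h2 : (2 * a + 1) / 2 = a := by omega
      rw [h1, h2, hxa]
      exact ⟨le_rfl, le_rfl⟩
    · rw [Function.update_of_ne hji]
      exact hx j
  · by_cases hji : j = i
    · subst hji
      rw [Function.update_self]
      exact Or.inr ⟨hi, ha⟩
    · rw [Function.update_of_ne hji]
      exact Or.inl rfl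

theorem isGridFace_or_mem_gridBoundary {z z' : κ → ℤ} {x : κ → ℝ} (hx : x ∈ gridCell z)
    (hx' : x ∈ gridCell z') : IsGridFace z z' ∨ x ∈ gridBoundary z := by
  by_contra! h
  obtain ⟨h1, h2⟩ := h
  apply h1
  intro i
  by_contra! hi
  apply h2
  refine ⟨hx, i, ?_⟩
  have h3 := hx i
  have h4 := hx' i
  obtain ⟨hi1, hi2⟩ := hi
  have h5 : z i / 2 ≤ (z' i + 1) / 2 := by exact_mod_cast h3.1.trans h4.2
  have h6 : z' i / 2 ≤ (z i + 1) / 2 := by exact_mod_cast h4.1.trans h3.2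
  have hodd : Odd (z i) := by
    by_contra hev
    rw [Int.not_odd_iff_even] at hev
    obtain ⟨b, hb⟩ := hev
    rcases Int.even_or_odd (z' i) with ⟨c, hc⟩ | ⟨c, hc⟩
    · omega
    · obtain ⟨h7, h8⟩ := hi2 ⟨c, hc⟩
      omega
  refine ⟨hodd, ?_⟩
  obtain ⟨b, hb⟩ := hodd
  rcases lt_or_gt_of_ne hi1 with hlt | hlt
  · right
    refine le_antisymm h3.2 (le_trans ?_ h4.1)
    exact_mod_cast (by omega : (z i + 1) / 2 ≤ z' i / 2)
  · left
    refine le_antisymm (le_trans h4.2 ?_) h3.1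
    exact_mod_cast (by omega : (z' i + 1) / 2 ≤ z i / 2)

theorem IsGridFace.eq_of_gridDim_le [Fintype κ] {z z' : κ → ℤ} (h : IsGridFace z z')
    (hd : gridDim z' ≤ gridDim z) : z = z' := by
  classical
  by_contra hne
  obtain ⟨i, hi⟩ := Function.ne_iff.1 hne
  have : gridDim z < gridDim z' := by
    refine Fintype.card_lt_of_injective_of_notMem (fun j => ⟨j.1, ?_⟩)
      (b := ⟨i, ((h i).resolve_left hi).1⟩) ?_ ?_
    · rcases h j with hj | hj
      · rw [← hj]; exact j.2
      · exact hj.1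
    · intro j k hjk
      simpa [Subtype.ext_iff] using hjk
    · rintro ⟨j, hj⟩
      have hji : j.1 = i := by simpa [Subtype.ext_iff] using hj
      have hj2 := j.2
      rw [hji] at hj2
      obtain ⟨ho, h1⟩ := (h i).resolve_left hi
      obtain ⟨b, hb⟩ := hj2
      obtain ⟨c, hc⟩ := ho
      omega
  omega

theorem IsGridFace.gridCell_subset {z z' : κ → ℤ} (h : IsGridFace z z') :
    gridCell z ⊆ gridCell z' := by
  intro x hx i
  rcases h i with hi | ⟨⟨b, hb⟩, hi⟩
  · rw [← hi]; exact hx i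
  · have h1 := hx i
    refine ⟨le_trans ?_ h1.1, h1.2.trans ?_⟩
    · exact_mod_cast (by omega : z' i / 2 ≤ z i / 2)
    · exact_mod_cast (by omega : (z i + 1) / 2 ≤ (z' i + 1) / 2)

end Grid

section Realization

/-- The geometric realization of the order complex of `P`, in terms of barycentric coordinates. -/
@[ext]
structure OrderRealization (P : Type*) [PartialOrder P] where
  /-- the barycentric coordinates -/
  val : P →₀ ℝ
  property : (∀ p, 0 ≤ val p) ∧ (∀ p q, val p ≠ 0 → val q ≠ 0 → p ≤ q ∨ q ≤ p) ∧
    (val.sum fun _ a => a) = 1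

namespace OrderRealization

variable {P : Type*} [PartialOrder P]

theorem ext_apply {x y : OrderRealization P} (h : ∀ p, x.1 p = y.1 p) : x = y :=
  OrderRealization.ext (Finsupp.ext h)

/-- The point of the realization given by a point of a simplex mapping onto a chain of `P`. -/
noncomputable def push {ι : Type*} [Fintype ι] (σ : ι → P) (hσ : ∀ i j, σ i ≤ σ j ∨ σ j ≤ σ i)
    (t : stdSimplex ℝ ι) : OrderRealization P :=
  ⟨Finsupp.mapDomain σ (Finsupp.equivFunOnFinite.symm t.1), by
    classical
    refine ⟨fun p => ?_, fun p q hp hq => ?_, ?_⟩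
    · rw [Finsupp.mapDomain, Finsupp.sum_apply]
      refine Finset.sum_nonneg fun i _ => ?_
      simp only [Finsupp.single_apply]
      split_ifs
      · exact t.2.1 i
      · exact le_rfl
    · have hp' := Finsupp.mapDomain_support (Finsupp.mem_support_iff.2 hp)
      have hq' := Finsupp.mapDomain_support (Finsupp.mem_support_iff.2 hq)
      obtain ⟨i, -, rfl⟩ := Finset.mem_image.1 hp'
      obtain ⟨j, -, rfl⟩ := Finset.mem_image.1 hq'
      exact hσ i j
    · rw [Finsupp.sum_mapDomain_index (fun _ => rfl) (fun _ _ _ => rfl)]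
      rw [Finsupp.sum_fintype _ _ (fun _ => rfl)]
      exact t.2.2⟩

section Push

variable {ι : Type*} [Fintype ι] (σ : ι → P) (hσ : ∀ i j, σ i ≤ σ j ∨ σ j ≤ σ i)

theorem push_apply [DecidableEq P] (t : stdSimplex ℝ ι) (p : P) :
    (push σ hσ t).1 p = ∑ i, if σ i = p then t i else 0 := by
  simp only [push]
  rw [Finsupp.mapDomain, Finsupp.sum_apply, Finsupp.sum_fintype _ _ (by simp)]
  refine Finset.sum_congr rfl fun i _ => ?_
  rw [Finsupp.single_apply]
  rfl

theorem push_map {κ : Type*} [Fintype κ] (θ : κ → ι) (t : stdSimplex ℝ κ) :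
    push σ hσ (stdSimplex.map θ t) = push (σ ∘ θ) (fun _ _ => hσ _ _) t := by
  classical
  refine OrderRealization.ext ?_
  rw [push, push]
  simp only
  rw [Finsupp.mapDomain_comp]
  congr 1
  refine (Equiv.symm_apply_eq _).2 ?_
  rfl

theorem push_apply_of_injective (hinj : Function.Injective σ) (t : stdSimplex ℝ ι) (i : ι) :
    (push σ hσ t).1 (σ i) = t i :=
  Finsupp.mapDomain_apply hinj _ _

theorem exists_of_push_ne_zero {t : stdSimplex ℝ ι} {p : P} (h : (push σ hσ t).1 p ≠ 0) :
    ∃ i, σ i = p := by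
  classical
  have := Finsupp.mapDomain_support (Finsupp.mem_support_iff.2 h)
  obtain ⟨i, -, hi⟩ := Finset.mem_image.1 this
  exact ⟨i, hi⟩

end Push

theorem push_val_of_support_subset (C : Finset P) (hC : ∀ i j : C, i.1 ≤ j.1 ∨ j.1 ≤ i.1)
    (x : OrderRealization P) (hx : x.1.support ⊆ C) :
    ∃ t : stdSimplex ℝ C, push Subtype.val hC t = x ∧ ∀ c : C, t c = x.1 c := by
  refine ⟨⟨fun c => x.1 c, fun c => x.2.1 c, ?_⟩, ?_, fun c => rfl⟩
  · rw [Finset.sum_coe_sort C (fun p => x.1 p), ← x.2.2.2, Finsupp.sum]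
    refine (Finset.sum_subset hx fun p _ hp => ?_).symm
    simpa using hp
  · refine ext_apply fun p => ?_
    by_cases hp : p ∈ C
    · exact push_apply_of_injective Subtype.val hC Subtype.val_injective _ ⟨p, hp⟩
    · have h1 : x.1 p = 0 := by
        by_contra h
        exact hp (hx (Finsupp.mem_support_iff.2 h))
      rw [h1]
      by_contra h
      obtain ⟨i, hi⟩ := exists_of_push_ne_zero _ _ h
      exact hp (hi ▸ i.2)

/-- The finite chains of a poset. -/
abbrev FinChain (P : Type*) [PartialOrder P] : Type _ :=
  {C : Finset P // ∀ i j : C, i.1 ≤ j.1 ∨ j.1 ≤ i.1}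

noncomputable instance : TopologicalSpace (OrderRealization P) :=
  ⨆ C : FinChain P, TopologicalSpace.coinduced (push (Subtype.val : C.1 → P) C.2) inferInstance

theorem continuous_iff {Y : Type*} [TopologicalSpace Y] {f : OrderRealization P → Y} :
    Continuous f ↔ ∀ C : FinChain P, Continuous (f ∘ push (Subtype.val : C.1 → P) C.2) := by
  rw [continuous_iSup_dom]
  exact forall_congr' fun C => continuous_coinduced_dom

theorem continuous_push {ι : Type*} [Fintype ι] (σ : ι → P)
    (hσ : ∀ i j, σ i ≤ σ j ∨ σ j ≤ σ i) : Continuous (push σ hσ) := by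
  classical
  let C : FinChain P := ⟨Finset.univ.image σ, by
    rintro ⟨i, hi⟩ ⟨j, hj⟩
    obtain ⟨i, -, rfl⟩ := Finset.mem_image.1 hi
    obtain ⟨j, -, rfl⟩ := Finset.mem_image.1 hj
    exact hσ i j⟩
  let θ : ι → C.1 := fun i => ⟨σ i, Finset.mem_image_of_mem _ (Finset.mem_univ _)⟩
  have h : push σ hσ = push (Subtype.val : C.1 → P) C.2 ∘ stdSimplex.map θ := by
    ext1 t
    exact (push_map _ C.2 θ t).symm
  rw [h]
  exact (continuous_iff.1 continuous_id C).comp (stdSimplex.continuous_map θ)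

theorem continuous_coord (p : P) : Continuous fun x : OrderRealization P => x.1 p := by
  classical
  refine continuous_iff.2 fun C => ?_
  have : ((fun x : OrderRealization P => x.1 p) ∘ push (Subtype.val : C.1 → P) C.2) =
      fun t => ∑ i : C.1, if i.1 = p then t i else 0 := by
    ext t
    exact push_apply _ _ _ _
  rw [this]
  refine continuous_finsetSum _ fun i _ => ?_
  split_ifs
  · exact (continuous_apply i).comp continuous_subtype_val
  · exact continuous_const

theorem isOpen_star (p : P) : IsOpen {x : OrderRealization P | x.1 p ≠ 0} :=
  isOpen_ne_fun (continuous_coord p) continuous_const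

theorem isClosed_iff {K : Set (OrderRealization P)} :
    IsClosed K ↔ ∀ C : FinChain P, IsClosed (push (Subtype.val : C.1 → P) C.2 ⁻¹' K) := by
  rw [isClosed_iSup_iff]
  exact forall_congr' fun C => isClosed_coinduced

theorem exists_ne_zero (x : OrderRealization P) : ∃ p, x.1 p ≠ 0 := by
  by_contra! h
  have : x.1 = 0 := Finsupp.ext h
  have h1 := x.2.2.2
  rw [this] at h1
  simp at h1

/-- The subcomplex of points supported on a set of vertices. -/
def supportedOn (Q : Set P) : Set (OrderRealization P) := {x | ∀ p, x.1 p ≠ 0 → p ∈ Q}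

theorem supportedOn_mono {Q Q' : Set P} (h : Q ⊆ Q') : supportedOn Q ⊆ supportedOn Q' :=
  fun _ hx p hp => h (hx p hp)

section Map

variable {P' : Type*} [PartialOrder P'] (e : P' ↪o P)

/-- The map of realizations induced by an order embedding. -/
noncomputable def map (x : OrderRealization P') : OrderRealization P :=
  ⟨Finsupp.mapDomain e x.1, by
    classical
    refine ⟨fun p => ?_, fun p q hp hq => ?_, ?_⟩
    · by_cases h : p ∈ Set.range e
      · obtain ⟨p, rfl⟩ := h
        rw [Finsupp.mapDomain_apply e.injective]
        exact x.2.1 p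
      · rw [Finsupp.mapDomain_of_notMem_range _ _ h]
    · have hp' := Finsupp.mapDomain_support (Finsupp.mem_support_iff.2 hp)
      have hq' := Finsupp.mapDomain_support (Finsupp.mem_support_iff.2 hq)
      obtain ⟨i, hi, rfl⟩ := Finset.mem_image.1 hp'
      obtain ⟨j, hj, rfl⟩ := Finset.mem_image.1 hq'
      rw [e.le_iff_le, e.le_iff_le]
      exact x.2.2.1 i j (by simpa using hi) (by simpa using hj)
    · rw [Finsupp.sum_mapDomain_index (fun _ => rfl) (fun _ _ _ => rfl)]
      exact x.2.2.2⟩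

theorem map_apply (x : OrderRealization P') (p : P') : (map e x).1 (e p) = x.1 p :=
  Finsupp.mapDomain_apply e.injective _ _

theorem map_apply_of_notMem (x : OrderRealization P') {p : P} (hp : p ∉ Set.range e) :
    (map e x).1 p = 0 :=
  Finsupp.mapDomain_of_notMem_range _ _ hp

theorem map_push {ι : Type*} [Fintype ι] (σ : ι → P') (hσ : ∀ i j, σ i ≤ σ j ∨ σ j ≤ σ i)
    (t : stdSimplex ℝ ι) :
    map e (push σ hσ t) = push (e ∘ σ) (fun i j => by simpa using hσ i j) t :=
  OrderRealization.ext (Finsupp.mapDomain_comp).symm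

theorem continuous_map : Continuous (map e) := by
  refine continuous_iff.2 fun C => ?_
  have : map e ∘ push (Subtype.val : C.1 → P') C.2 =
      push (e ∘ Subtype.val) (fun i j => by simpa using C.2 i j) := by
    ext1 t
    exact map_push _ _ _ _
  rw [this]
  exact continuous_push _ _

theorem map_injective : Function.Injective (map e) := fun x y h =>
  ext_apply fun p => by rw [← map_apply e, h, map_apply]

theorem isClosedEmbedding_map : Topology.IsClosedEmbedding (map e) := by
  classical
  refine .of_continuous_injective_isClosedMap (continuous_map e) (map_injective e) fun K hK => ?_
  refine isClosed_iff.2 fun C => ?_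
  let C' : FinChain P' := ⟨C.1.preimage e e.injective.injOn, fun i j => by
    have := C.2 ⟨e i, Finset.mem_preimage.1 i.2⟩ ⟨e j, Finset.mem_preimage.1 j.2⟩
    simpa using this⟩
  have hC' : ∀ i : C'.1, e i.1 ∈ C.1 := fun i =>
    (Finset.mem_preimage (hf := e.injective.injOn)).1 i.2
  let θ : C'.1 → C.1 := fun i => ⟨e i, hC' i⟩
  have hθ : ∀ t, push (Subtype.val : C.1 → P) C.2 (stdSimplex.map θ t) =
      map e (push (Subtype.val : C'.1 → P') C'.2 t) := fun t => by
    rw [push_map, map_push]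
    rfl
  have h : push (Subtype.val : C.1 → P) C.2 ⁻¹' (map e '' K) =
      stdSimplex.map θ '' (push (Subtype.val : C'.1 → P') C'.2 ⁻¹' K) := by
    ext t
    constructor
    · rintro ⟨x, hx, hxt⟩
      obtain ⟨t', ht', -⟩ := push_val_of_support_subset C'.1 C'.2 x (by
        intro p hp
        refine (Finset.mem_preimage (hf := e.injective.injOn)).2 ?_
        have : (push (Subtype.val : C.1 → P) C.2 t).1 (e p) ≠ 0 := by
          rw [← hxt, map_apply]
          simpa using hp
        obtain ⟨i, hi⟩ := exists_of_push_ne_zero _ _ this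
        exact hi ▸ i.2)
      refine ⟨t', by rwa [Set.mem_preimage, ht'], ?_⟩
      have h1 := hθ t'
      rw [ht', hxt] at h1
      refine Subtype.ext (funext fun c => ?_)
      have h2 := push_apply_of_injective _ C.2 Subtype.val_injective (stdSimplex.map θ t') c
      rw [h1, push_apply_of_injective _ C.2 Subtype.val_injective] at h2
      exact h2.symm
    · rintro ⟨t', ht', rfl⟩
      exact ⟨_, ht', (hθ t').symm⟩
  rw [h]
  have hcl : IsClosed (push (Subtype.val : C'.1 → P') C'.2 ⁻¹' K) :=
    hK.preimage (continuous_push _ _)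
  exact (hcl.isCompact.image (stdSimplex.continuous_map θ)).isClosed

theorem range_map : Set.range (map e) = supportedOn (Set.range e) := by
  ext x
  constructor
  · rintro ⟨y, rfl⟩ p hp
    by_contra h
    exact hp (map_apply_of_notMem e y h)
  · intro hx
    refine ⟨⟨x.1.comapDomain e e.injective.injOn, fun p => x.2.1 _, fun p q hp hq => ?_, ?_⟩, ?_⟩
    · have := x.2.2.1 (e p) (e q) hp hq
      simpa using this
    · rw [← x.2.2.2]
      refine Finsupp.sum_comapDomain e x.1 (fun _ a => a) ⟨fun p hp => hp, e.injective.injOn, ?_⟩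
      intro p hp
      obtain ⟨q, rfl⟩ := hx p (by simpa using hp)
      exact ⟨q, by simpa using hp, rfl⟩
    · refine ext_apply fun p => ?_
      by_cases hp : p ∈ Set.range e
      · obtain ⟨p, rfl⟩ := hp
        exact map_apply e _ p
      · rw [map_apply_of_notMem e _ hp]
        by_contra h
        exact hp (hx p (Ne.symm h))

end Map

section Cone

variable {q : P} (hq : ∀ p, p ≤ q ∨ q ≤ p)

/-- The linear contraction of the realization towards a vertex comparable to all others. -/
noncomputable def contract (s : unitInterval) (x : OrderRealization P) : OrderRealization P :=
  ⟨(1 - s.1) • x.1 + s.1 • Finsupp.single q 1, by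
    classical
    refine ⟨fun p => ?_, fun p p' hp hp' => ?_, ?_⟩
    · have h1 := x.2.1 p
      have h2 := s.2.1
      have h3 : 0 ≤ 1 - s.1 := sub_nonneg.2 s.2.2
      have h4 : 0 ≤ (Finsupp.single q (1 : ℝ)) p := by
        rw [Finsupp.single_apply]; split_ifs <;> norm_num
      simp only [Finsupp.add_apply, Finsupp.smul_apply, smul_eq_mul]
      positivity
    · have key : ∀ p, ((1 - s.1) • x.1 + s.1 • Finsupp.single q (1 : ℝ)) p ≠ 0 →
          p = q ∨ x.1 p ≠ 0 := by
        intro p hp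
        by_contra! h
        apply hp
        simp [h.2, h.1.symm]
      rcases key p hp with rfl | h
      · exact (hq p').symm
      · rcases key p' hp' with rfl | h'
        · exact hq p
        · exact x.2.2.1 p p' h h'
    · have hx := x.2.2.2
      rw [Finsupp.sum_add_index (fun _ _ => rfl) (fun _ _ _ _ => rfl),
        Finsupp.sum_smul_index' (fun _ => rfl), Finsupp.sum_smul_index' (fun _ => rfl),
        ← Finsupp.smul_sum, ← Finsupp.smul_sum, hx]
      simp⟩

theorem continuous_contract :
    Continuous fun z : OrderRealization P × unitInterval => contract hq z.2 z.1 := by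
  classical
  let H : OrderRealization P → (unitInterval → OrderRealization P) := fun x s => contract hq s x
  have h1 : ∀ C : FinChain P, Continuous fun z : stdSimplex ℝ C.1 × unitInterval =>
      contract hq z.2 (push (Subtype.val : C.1 → P) C.2 z.1) := by
    intro C
    let σ : Option C.1 → P := fun o => o.elim q Subtype.val
    have hσ : ∀ i j, σ i ≤ σ j ∨ σ j ≤ σ i := by
      rintro (_ | i) (_ | j)
      · exact Or.inl le_rfl
      · exact (hq _).symm
      · exact hq _
      · exact C.2 i j
    let h : stdSimplex ℝ C.1 × unitInterval → stdSimplex ℝ (Option C.1) := fun z =>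
      ⟨fun o => o.elim z.2.1 fun i => (1 - z.2.1) * z.1.1 i, by
        refine ⟨?_, ?_⟩
        · rintro (_ | i)
          · exact z.2.2.1
          · exact mul_nonneg (sub_nonneg.2 z.2.2.2) (z.1.2.1 i)
        · rw [Fintype.sum_option]
          simp only [Option.elim]
          rw [← Finset.mul_sum, z.1.2.2]
          ring⟩
    have hh : Continuous h := by
      refine Continuous.subtype_mk (continuous_pi ?_) _
      rintro (_ | i)
      · exact continuous_subtype_val.comp continuous_snd
      · refine Continuous.mul (continuous_const.sub (continuous_subtype_val.comp continuous_snd)) ?_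
        exact (continuous_apply i).comp (continuous_subtype_val.comp continuous_fst)
    have heq : (fun z : stdSimplex ℝ C.1 × unitInterval =>
        contract hq z.2 (push (Subtype.val : C.1 → P) C.2 z.1)) = push σ hσ ∘ h := by
      ext1 z
      refine ext_apply fun p => ?_
      rw [Function.comp_apply, push_apply, Fintype.sum_option, contract]
      simp only [Finsupp.add_apply, Finsupp.smul_apply, smul_eq_mul]
      rw [push_apply, Finsupp.single_apply, add_comm, Finset.mul_sum]
      congr 1
      · change _ = if q = p then z.2.1 else 0
        simp
      · refine Finset.sum_congr rfl fun i _ => ?_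
        change _ = if i.1 = p then (1 - z.2.1) * z.1.1 i else 0
        split_ifs
        · rfl
        · simp
    rw [heq]
    exact (continuous_push _ _).comp hh
  let G : OrderRealization P → C(unitInterval, OrderRealization P) := fun x =>
    ⟨fun s => contract hq s x, by
      obtain ⟨t, ht, -⟩ := push_val_of_support_subset x.1.support (fun i j =>
        x.2.2.1 _ _ (Finsupp.mem_support_iff.1 i.2) (Finsupp.mem_support_iff.1 j.2)) x subset_rfl
      have := (h1 ⟨x.1.support, fun i j => x.2.2.1 _ _ (Finsupp.mem_support_iff.1 i.2)
        (Finsupp.mem_support_iff.1 j.2)⟩).comp (Continuous.prodMk_right t)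
      simpa [Function.comp_def, ht] using this⟩
  have hG : Continuous G := by
    refine continuous_iff.2 fun C => ?_
    refine ContinuousMap.continuous_of_continuous_uncurry _ ?_
    exact h1 C
  exact ContinuousMap.continuous_uncurry_of_continuous ⟨G, hG⟩

theorem contract_zero (x : OrderRealization P) : contract hq 0 x = x := by
  refine OrderRealization.ext ?_
  simp [contract]

theorem contract_one (x y : OrderRealization P) : contract hq 1 x = contract hq 1 y := by
  refine OrderRealization.ext ?_
  simp [contract]

end Cone

end OrderRealization

end Realization

section Fills

open OrderRealization

theorem fillsSphere_supportedOn_range {P P' : Type*} [PartialOrder P] [PartialOrder P']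
    (e : P' ↪o P) {n : ℕ} [Nonempty P']
    (h : FillsSphere n (Set.univ : Set (OrderRealization P'))) :
    FillsSphere n (supportedOn (Set.range e)) := by
  classical
  obtain ⟨p⟩ := ‹Nonempty P'›
  have : Nonempty (OrderRealization P') :=
    ⟨push (fun _ : Unit => p) (fun _ _ => Or.inl le_rfl) default⟩
  intro f hf hfS
  have hinv : ∀ x ∈ Metric.sphere (0 : Fin n → ℝ) 1, ∃ y, map e y = f x := fun x hx => by
    have := hfS hx
    rwa [← range_map] at this
  choose! f' hf' using hinv
  obtain ⟨g, hg, -, hgf⟩ := h f' (by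
    rw [(isClosedEmbedding_map e).isInducing.continuousOn_iff]
    exact hf.congr hf') (Set.mapsTo_univ _ _)
  refine ⟨map e ∘ g, (continuous_map e).comp_continuousOn hg, fun x _ => ?_, fun x hx => ?_⟩
  · rw [← range_map]
    exact ⟨_, rfl⟩
  · rw [Function.comp_apply, hgf hx, hf' x hx]

theorem fillsSphere_of_comparable {P : Type*} [PartialOrder P] {q : P}
    (hq : ∀ p, p ≤ q ∨ q ≤ p) (n : ℕ) :
    FillsSphere n (Set.univ : Set (OrderRealization P)) := by
  classical
  intro f hf _
  let x₀ : OrderRealization P := push (fun _ : Unit => q) (fun _ _ => Or.inl le_rfl) default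
  let σ : (Fin n → ℝ) → unitInterval := fun y => Set.projIcc 0 1 zero_le_one (2 - 2 * ‖y‖)
  let k : (Fin n → ℝ) → OrderRealization P := fun y => contract hq (σ y) (f (‖y‖⁻¹ • y))
  let g : (Fin n → ℝ) → OrderRealization P := fun y =>
    if ‖y‖ ≤ 1 / 2 then contract hq 1 x₀ else k y
  have hk : ContinuousOn k {y | 1 / 2 ≤ ‖y‖} := by
    have h1 : ContinuousOn (fun y : Fin n → ℝ => ‖y‖⁻¹ • y) {y | 1 / 2 ≤ ‖y‖} := by
      refine ContinuousOn.smul (ContinuousOn.inv₀ continuous_norm.continuousOn ?_) continuousOn_id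
      intro y hy
      have : (1 / 2 : ℝ) ≤ ‖y‖ := hy
      linarith
    have h2 : Set.MapsTo (fun y : Fin n → ℝ => ‖y‖⁻¹ • y) {y | 1 / 2 ≤ ‖y‖}
        (Metric.sphere 0 1) := by
      intro y hy
      have hy : (1 / 2 : ℝ) ≤ ‖y‖ := hy
      have : ‖y‖ ≠ 0 := by linarith
      simp only [mem_sphere_iff_norm, sub_zero, norm_smul, norm_inv, norm_norm]
      field_simp
    have h3 : Continuous σ := by
      have h : Continuous fun y : Fin n → ℝ => 2 - 2 * ‖y‖ := by fun_prop
      exact continuous_projIcc.comp h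
    have h4 : ContinuousOn (fun y : Fin n → ℝ => f (‖y‖⁻¹ • y)) {y | 1 / 2 ≤ ‖y‖} :=
      hf.comp h1 h2
    have h5 : ContinuousOn (fun y => (f (‖y‖⁻¹ • y), σ y)) {y | 1 / 2 ≤ ‖y‖} :=
      h4.prodMk h3.continuousOn
    have h6 := continuous_contract hq
    generalize {y : Fin n → ℝ | 1 / 2 ≤ ‖y‖} = A at h5 ⊢
    have h7 := h6.comp_continuousOn h5
    exact h7
  have hgk : Set.EqOn g k {y | 1 / 2 ≤ ‖y‖} := by
    intro y hy
    by_cases h : ‖y‖ ≤ 1 / 2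
    · have hy' : ‖y‖ = 1 / 2 := le_antisymm h hy
      simp only [g, if_pos h, k, σ]
      rw [Set.projIcc_of_right_le _ (by rw [hy']; norm_num)]
      exact contract_one hq _ _
    · simp only [g, if_neg h]
  refine ⟨g, ?_, Set.mapsTo_univ _ _, fun y hy => ?_⟩
  · have h1 : ContinuousOn g {y | ‖y‖ ≤ 1 / 2} :=
      (continuousOn_const (c := contract hq 1 x₀)).congr fun y hy => if_pos hy
    have h2 : ContinuousOn g {y | 1 / 2 ≤ ‖y‖} := hk.congr hgk
    refine (ContinuousOn.union_of_isClosed h1 h2 (isClosed_le continuous_norm continuous_const)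
      (isClosed_le continuous_const continuous_norm)).mono fun y _ => ?_
    exact le_total ‖y‖ (1 / 2)
  · have hy' : ‖y‖ = 1 := by simpa using hy
    rw [hgk (show 1 / 2 ≤ ‖y‖ by rw [hy']; norm_num)]
    simp only [k, σ, hy', inv_one, one_smul]
    rw [Set.projIcc_of_le_left _ (by norm_num)]
    exact contract_zero hq _

/-- A combinatorial version of `D`-connectedness of the realization of a poset. -/
def PosetFills (P : Type*) [PartialOrder P] (D : ℤ) : Prop :=
  (-1 ≤ D → Nonempty P) ∧
    ∀ n : ℕ, (n : ℤ) ≤ D + 1 → FillsSphere n (Set.univ : Set (OrderRealization P))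

variable {P : Type*} [PartialOrder P]

theorem PosetFills.mono {D D' : ℤ} (h : PosetFills P D) (hD : D' ≤ D) : PosetFills P D' :=
  ⟨fun h' => h.1 (by omega), fun n hn => h.2 n (by omega)⟩

theorem PosetFills.of_lt {D : ℤ} (hD : D < -1) : PosetFills P D :=
  ⟨fun h' => by omega, fun n hn => by omega⟩

theorem PosetFills.of_comparable {q : P} (hq : ∀ p, p ≤ q ∨ q ≤ p) (D : ℤ) : PosetFills P D :=
  ⟨fun _ => ⟨q⟩, fun n _ => fillsSphere_of_comparable hq n⟩

theorem PosetFills.fillsSphere_supportedOn {Q : Set P} {D : ℤ} (h : PosetFills Q D) {n : ℕ}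
    (hn : (n : ℤ) ≤ D + 1) : FillsSphere n (supportedOn Q) := by
  have := h.1 (by omega)
  have h2 := fillsSphere_supportedOn_range (OrderEmbedding.subtype (· ∈ Q)) (h.2 n hn)
  have : Set.range (OrderEmbedding.subtype (· ∈ Q)) = Q := Subtype.range_coe
  rwa [this] at h2

theorem PosetFills.congr {P' : Type*} [PartialOrder P'] (e : P ≃o P') {D : ℤ}
    (h : PosetFills P D) : PosetFills P' D := by
  refine ⟨fun hD => (h.1 hD).map e, fun n hn => ?_⟩
  have := h.1 (by omega)
  have h2 := fillsSphere_supportedOn_range e.toOrderEmbedding (h.2 n hn)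
  have h3 : supportedOn (Set.range e.toOrderEmbedding) = Set.univ := by
    refine Set.eq_univ_of_forall fun x p _ => ⟨e.symm p, by simp⟩
  rwa [h3] at h2

theorem PosetFills.of_nonempty (h : Nonempty P) {D : ℤ} (hD : D ≤ -1) : PosetFills P D := by
  refine ⟨fun _ => h, fun n hn => ?_⟩
  obtain rfl : n = 0 := by omega
  intro f hf _
  refine ⟨f, ?_, Set.mapsTo_univ _ _, fun x _ => rfl⟩
  exact (Set.subsingleton_of_subsingleton).continuousOn f

end Fills

section GridCube

theorem norm_sub_le_one_of_mem_gridCell {κ : Type*} [Fintype κ] {z : κ → ℤ} {x y : κ → ℝ}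
    (hx : x ∈ gridCell z) (hy : y ∈ gridCell z) : ‖x - y‖ ≤ 1 := by
  rw [pi_norm_le_iff_of_nonneg zero_le_one]
  intro i
  have h1 := hx i
  have h2 := hy i
  have h3 : (((z i + 1) / 2 : ℤ) : ℝ) ≤ ((z i / 2 : ℤ) : ℝ) + 1 := by
    exact_mod_cast (by omega : (z i + 1) / 2 ≤ z i / 2 + 1)
  rw [Real.norm_eq_abs, abs_le, Pi.sub_apply]
  constructor <;> linarith

theorem mem_gridCell_floor_add_ceil {κ : Type*} (x : κ → ℝ) :
    x ∈ gridCell fun i => ⌊x i⌋ + ⌈x i⌉ := by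
  intro i
  have h1 : ⌊x i⌋ ≤ ⌈x i⌉ := Int.floor_le_ceil _
  have h2 : ⌈x i⌉ ≤ ⌊x i⌋ + 1 := Int.ceil_le_floor_add_one _
  constructor
  · refine le_trans ?_ (Int.floor_le (x i))
    exact_mod_cast (by omega : (⌊x i⌋ + ⌈x i⌉) / 2 ≤ ⌊x i⌋)
  · refine (Int.le_ceil (x i)).trans ?_
    exact_mod_cast (by omega : ⌈x i⌉ ≤ (⌊x i⌋ + ⌈x i⌉ + 1) / 2)

/-- The cells of the grid contained in the boundary of the cube `[-N, N]^κ`. -/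
def gridSphere (κ : Type*) (N : ℕ) : Set (κ → ℤ) :=
  {z | (∀ i, |z i| ≤ 2 * N) ∧ ∃ i, |z i| = 2 * N}

theorem gridCell_subset_sphere {κ : Type*} [Fintype κ] {N : ℕ} {z : κ → ℤ}
    (hz : z ∈ gridSphere κ N) : gridCell z ⊆ Metric.sphere 0 N := by
  intro x hx
  obtain ⟨h1, i, hi⟩ := hz
  rw [mem_sphere_zero_iff_norm]
  refine le_antisymm ?_ ?_
  · rw [pi_norm_le_iff_of_nonneg (Nat.cast_nonneg N)]
    intro j
    have h2 := hx j
    have h3 := abs_le.1 (h1 j)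
    rw [Real.norm_eq_abs, abs_le]
    constructor
    · refine le_trans ?_ h2.1
      exact_mod_cast (by omega : -(N : ℤ) ≤ z j / 2)
    · refine h2.2.trans ?_
      exact_mod_cast (by omega : (z j + 1) / 2 ≤ (N : ℤ))
  · refine le_trans ?_ (norm_le_pi_norm x i)
    have h2 := hx i
    rw [Real.norm_eq_abs, le_abs]
    rcases (abs_eq (by positivity)).1 hi with h | h
    · left
      refine le_trans ?_ h2.1
      exact_mod_cast (by omega : (N : ℤ) ≤ z i / 2)
    · right
      have : (((z i + 1) / 2 : ℤ) : ℝ) ≤ ((-N : ℤ) : ℝ) := by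
        exact_mod_cast (by omega : (z i + 1) / 2 ≤ -(N : ℤ))
      push_cast at this h2
      linarith

theorem abs_floor_add_ceil_le {N : ℕ} {a : ℝ} (h : |a| ≤ N) : |⌊a⌋ + ⌈a⌉| ≤ 2 * (N : ℤ) := by
  rw [abs_le] at h ⊢
  have h1 : -(N : ℤ) ≤ ⌊a⌋ := Int.le_floor.2 (by push_cast; exact h.1)
  have h2 : ⌈a⌉ ≤ (N : ℤ) := Int.ceil_le.2 (by push_cast; exact h.2)
  have h3 : ⌊a⌋ ≤ ⌈a⌉ := Int.floor_le_ceil _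
  constructor <;> omega

theorem abs_floor_add_ceil_eq {N : ℕ} {a : ℝ} (h : |a| = N) : |⌊a⌋ + ⌈a⌉| = 2 * (N : ℤ) := by
  rcases (abs_eq (Nat.cast_nonneg N)).1 h with rfl | rfl
  · simp [two_mul]
  · rw [Int.floor_neg, Int.ceil_neg, Int.floor_natCast, Int.ceil_natCast, abs_eq (by positivity)]
    right
    ring

theorem floor_add_ceil_mem_gridSphere {κ : Type*} [Fintype κ] {N : ℕ} (hN : 0 < N) {x : κ → ℝ}
    (hx : ‖x‖ = N) : (fun i => ⌊x i⌋ + ⌈x i⌉) ∈ gridSphere κ N := by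
  have h1 : ∀ i, |x i| ≤ N := fun i => hx ▸ norm_le_pi_norm x i
  refine ⟨fun i => abs_floor_add_ceil_le (h1 i), ?_⟩
  by_contra! h
  have : ‖x‖ < N := (pi_norm_lt_iff (by exact_mod_cast hN)).2 fun i =>
    lt_of_le_of_ne (h1 i) fun hi => h i (abs_floor_add_ceil_eq hi)
  linarith

theorem IsGridFace.mem_gridSphere {κ : Type*} {N : ℕ} {z z' : κ → ℤ} (h : IsGridFace z z')
    (hz : z' ∈ gridSphere κ N) : z ∈ gridSphere κ N := by
  obtain ⟨h1, i, hi⟩ := hz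
  have h2 : ∀ i, |z i| ≤ 2 * (N : ℤ) := fun i => by
    rcases h i with hi | ⟨⟨b, hb⟩, hi⟩
    · rw [hi]; exact h1 i
    · have := abs_le.1 (h1 i)
      rw [abs_le]
      constructor <;> omega
  refine ⟨h2, i, ?_⟩
  rcases h i with hi' | ⟨⟨b, hb⟩, hi'⟩
  · rw [hi', hi]
  · rcases (abs_eq (by positivity)).1 hi with h | h <;> omega

theorem IsGridFace.trans {κ : Type*} {z z' z'' : κ → ℤ} (h : IsGridFace z z')
    (h' : IsGridFace z' z'') : IsGridFace z z'' := by
  intro i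
  rcases h i with h1 | ⟨⟨b, hb⟩, h1⟩
  · rw [h1]; exact h' i
  · rcases h' i with h2 | ⟨⟨c, hc⟩, h2⟩
    · rw [← h2]; exact Or.inr ⟨⟨b, hb⟩, h1⟩
    · omega

theorem finite_gridSphere (κ : Type*) [Finite κ] (N : ℕ) : (gridSphere κ N).Finite := by
  classical
  have := Fintype.ofFinite κ
  refine (Set.finite_Icc (fun _ : κ => -(2 * (N : ℤ))) (fun _ => 2 * (N : ℤ))).subset fun z hz => ?_
  exact ⟨fun i => (abs_le.1 (hz.1 i)).1, fun i => (abs_le.1 (hz.1 i)).2⟩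

end GridCube

section LinkExtension

open OrderRealization

variable {P : Type*} [PartialOrder P]

/-- The elements comparable to all elements of `R`. -/
def comparables (R : Set P) : Set P := {q | ∀ r ∈ R, q ≤ r ∨ r ≤ q}

theorem fillsSphere_supportedOn_of_comparable {Q : Set P} {r : P} (hr : r ∈ Q)
    (h : ∀ q ∈ Q, q ≤ r ∨ r ≤ q) (n : ℕ) : FillsSphere n (supportedOn Q) := by
  have : PosetFills Q n := PosetFills.of_comparable (q := ⟨r, hr⟩) (fun p => h p.1 p.2) n
  exact this.fillsSphere_supportedOn (by omega)

theorem exists_star_cover {k : ℕ} {f : (Fin k → ℝ) → OrderRealization P}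
    (hf : ContinuousOn f (Metric.sphere 0 1)) :
    ∃ N : ℕ, 0 < N ∧ ∀ z ∈ gridSphere (Fin k) N, ∃ p : P, ∀ x ∈ gridCell z,
      (f ((N : ℝ)⁻¹ • x)).1 p ≠ 0 := by
  have hU : ∀ p : P, ∃ U : Set (Fin k → ℝ), IsOpen U ∧
      f ⁻¹' {x | x.1 p ≠ 0} ∩ Metric.sphere 0 1 = U ∩ Metric.sphere 0 1 := fun p =>
    continuousOn_iff'.1 hf _ (isOpen_star p)
  choose U hUo hU using hU
  obtain ⟨δ, hδ, hleb⟩ := lebesgue_number_lemma_of_metric (isCompact_sphere (0 : Fin k → ℝ) 1)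
    hUo (fun x hx => by
      obtain ⟨p, hp⟩ := exists_ne_zero (f x)
      exact Set.mem_iUnion.2 ⟨p, ((hU p).subset ⟨hp, hx⟩).1⟩)
  obtain ⟨n, hn⟩ := exists_nat_one_div_lt hδ
  have hpos : (0 : ℝ) < ((n + 1 : ℕ) : ℝ) := by positivity
  refine ⟨n + 1, Nat.succ_pos n, fun z hz => ?_⟩
  have hsph : ∀ x ∈ gridCell z, (((n + 1 : ℕ) : ℝ)⁻¹ • x) ∈ Metric.sphere (0 : Fin k → ℝ) 1 := by
    intro x hx
    have := gridCell_subset_sphere hz hx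
    rw [mem_sphere_zero_iff_norm] at this ⊢
    rw [norm_smul, this, norm_inv, Real.norm_of_nonneg hpos.le]
    exact inv_mul_cancel₀ hpos.ne'
  obtain ⟨x₀, hx₀⟩ : (gridCell z).Nonempty := by
    refine ⟨fun i => ((z i / 2 : ℤ) : ℝ), fun i => ⟨le_rfl, ?_⟩⟩
    exact Int.cast_le.2 (by omega : z i / 2 ≤ (z i + 1) / 2)
  obtain ⟨p, hp⟩ := hleb _ (hsph x₀ hx₀)
  refine ⟨p, fun x hx => ?_⟩
  refine ((hU p).superset ⟨hp ?_, hsph x hx⟩).1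
  rw [Metric.mem_ball, dist_eq_norm, ← smul_sub, norm_smul, norm_inv, Real.norm_of_nonneg hpos.le]
  calc ((n + 1 : ℕ) : ℝ)⁻¹ * ‖x - x₀‖ ≤ ((n + 1 : ℕ) : ℝ)⁻¹ * 1 :=
        mul_le_mul_of_nonneg_left (norm_sub_le_one_of_mem_gridCell hx hx₀) (by positivity)
    _ = 1 / ((n : ℝ) + 1) := by push_cast; rw [mul_one, one_div]
    _ < δ := hn

/-- The cells of the cylinder over the boundary of the cube, with the top filled. -/
def gridDrum (k N : ℕ) : Set (Fin (k + 1) → ℤ) :=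
  {z | (0 ≤ z 0 ∧ z 0 ≤ 2) ∧ (∀ i : Fin k, |z i.succ| ≤ 2 * N) ∧
    (Fin.tail z ∈ gridSphere (Fin k) N ∨ z 0 = 2)}

theorem finite_gridDrum (k N : ℕ) : (gridDrum k N).Finite := by
  refine (Set.finite_Icc (fun _ : Fin (k + 1) => -(2 * (N : ℤ) + 2))
    (fun _ => 2 * (N : ℤ) + 2)).subset fun z hz => ?_
  obtain ⟨h1, h2, -⟩ := hz
  have : ∀ i, -(2 * (N : ℤ) + 2) ≤ z i ∧ z i ≤ 2 * (N : ℤ) + 2 := by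
    intro i
    refine Fin.cases ?_ (fun i => ?_) i
    · constructor <;> omega
    · have := abs_le.1 (h2 i)
      constructor <;> omega
  exact ⟨fun i => (this i).1, fun i => (this i).2⟩

theorem IsGridFace.tail {k : ℕ} {z z' : Fin (k + 1) → ℤ} (h : IsGridFace z z') :
    IsGridFace (Fin.tail z) (Fin.tail z') := fun i => h i.succ

theorem IsGridFace.mem_gridDrum {k N : ℕ} {z z' : Fin (k + 1) → ℤ} (h : IsGridFace z z')
    (hz : z' ∈ gridDrum k N) : z ∈ gridDrum k N := by
  obtain ⟨h1, h2, h3⟩ := hz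
  refine ⟨?_, fun i => ?_, ?_⟩
  · rcases h 0 with h0 | ⟨⟨b, hb⟩, h0⟩ <;> omega
  · rcases h i.succ with hi | ⟨⟨b, hb⟩, hi⟩
    · rw [hi]; exact h2 i
    · have := abs_le.1 (h2 i)
      rw [abs_le]
      constructor <;> omega
  · rcases h3 with h3 | h3
    · exact Or.inl (h.tail.mem_gridSphere h3)
    · right
      rcases h 0 with h0 | ⟨⟨b, hb⟩, h0⟩ <;> omega

theorem gridDim_le_of_top {k N : ℕ} {z : Fin (k + 1) → ℤ} (h : z 0 = 2) :
    gridDim z ≤ k ∧ (Fin.tail z ∈ gridSphere (Fin k) N → gridDim z < k) := by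
  classical
  have h0 : gridDim z = gridDim (Fin.tail z) := by
    rw [gridDim, gridDim]
    refine (Fintype.card_of_bijective (f := fun i : {i // Odd (Fin.tail z i)} =>
      (⟨i.1.succ, i.2⟩ : {i // Odd (z i)})) ⟨fun i j hij => ?_, fun j => ?_⟩).symm
    · simpa [Subtype.ext_iff] using hij
    · obtain ⟨j, hj⟩ := j
      induction j using Fin.cases with
      | zero => rw [h] at hj; exact absurd hj (by decide)
      | succ j => exact ⟨⟨j, hj⟩, rfl⟩
  rw [h0]
  have hle : gridDim (Fin.tail z) ≤ Fintype.card (Fin k) := Fintype.card_subtype_le _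
  refine ⟨by simpa using hle, fun ⟨_, i, hi⟩ => ?_⟩
  have : gridDim (Fin.tail z) < Fintype.card (Fin k) := by
    refine Fintype.card_subtype_lt (x := i) fun ho => ?_
    obtain ⟨b, hb⟩ := ho
    rcases (abs_eq (by positivity)).1 hi with h | h <;> omega
  simpa using this

/-- If every finite part of `P` has a `D`-connected subposet `Q` such that the links in `Q` of
the chains outside of `Q` are `(D - 1)`-connected, then `P` is `D`-connected. -/
theorem PosetFills.of_links {D : ℤ}
    (h : ∀ S : Set P, S.Finite → ∃ Q : Set P, PosetFills Q D ∧ ∀ R ⊆ S, R.Nonempty →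
      (∀ r ∈ R, ∀ r' ∈ R, r ≤ r' ∨ r' ≤ r) → Disjoint R Q →
        PosetFills ↥(Q ∩ comparables R) (D - 1)) : PosetFills P D := by
  classical
  refine ⟨fun hD => ?_, fun k hk f hf _ => ?_⟩
  · obtain ⟨Q, hQ, -⟩ := h ∅ Set.finite_empty
    exact (hQ.1 hD).map Subtype.val
  obtain ⟨N, hN, hstar⟩ := exists_star_cover hf
  have : Nonempty P := by
    obtain ⟨Q, hQ, -⟩ := h ∅ Set.finite_empty
    exact (hQ.1 (by omega)).map Subtype.val
  choose! p hp using hstar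
  obtain ⟨Q, hQ, hlink⟩ := h (p '' gridSphere (Fin k) N) ((finite_gridSphere _ N).image p)
  let R : (Fin k → ℤ) → Set P := fun z => p '' {z' ∈ gridSphere (Fin k) N | IsGridFace z z'}
  have hRchain : ∀ z ∈ gridSphere (Fin k) N, ∀ r ∈ R z, ∀ r' ∈ R z, r ≤ r' ∨ r' ≤ r := by
    rintro z hz _ ⟨z₁, ⟨hz₁, hf₁⟩, rfl⟩ _ ⟨z₂, ⟨hz₂, hf₂⟩, rfl⟩
    have hx := fun i => (⟨le_rfl, by exact_mod_cast (by omega : z i / 2 ≤ (z i + 1) / 2)⟩ :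
      ((z i / 2 : ℤ) : ℝ) ≤ ((z i / 2 : ℤ) : ℝ) ∧
        ((z i / 2 : ℤ) : ℝ) ≤ (((z i + 1) / 2 : ℤ) : ℝ))
    exact (f _).2.2.1 _ _ (hp z₁ hz₁ _ (hf₁.gridCell_subset hx))
      (hp z₂ hz₂ _ (hf₂.gridCell_subset hx))
  have hRself : ∀ z ∈ gridSphere (Fin k) N, p z ∈ R z := fun z hz =>
    ⟨z, ⟨hz, fun i => Or.inl rfl⟩, rfl⟩
  have hRanti : ∀ z z', IsGridFace z z' → comparables (R z) ⊆ comparables (R z') := by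
    rintro z z' hzz' q hq _ ⟨z₁, ⟨hz₁, hf₁⟩, rfl⟩
    exact hq _ ⟨z₁, ⟨hz₁, hzz'.trans hf₁⟩, rfl⟩
  let ι := gridDrum k N
  have : Finite ι := (finite_gridDrum k N).to_subtype
  let Φ : ι → Set (OrderRealization P) := fun c =>
    supportedOn ((if c.1 0 = 2 then Q else Set.univ) ∩ comparables (R (Fin.tail c.1)))
  have htop : ∀ c : ι, ¬ c.1 0 = 2 → Fin.tail c.1 ∈ gridSphere (Fin k) N := fun c hc =>
    c.2.2.2.resolve_right hc
  let F : (Fin (k + 1) → ℝ) → OrderRealization P := fun x => f ((N : ℝ)⁻¹ • Fin.tail x)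
  have htail : ∀ (z : Fin (k + 1) → ℤ) (x : Fin (k + 1) → ℝ), x ∈ gridCell z →
      Fin.tail x ∈ gridCell (Fin.tail z) := fun z x hx i => hx i.succ
  have hNR : (0 : ℝ) < N := by exact_mod_cast hN
  refine Exists.elim (exists_carried_extension (ι := ι) (fun c => gridCell c.1)
    (fun c => gridBoundary c.1) (fun c => gridDim c.1) (fun c => isClosed_gridCell c.1)
    (fun c x hx => hx.1) (fun c => isCubeCell_gridCell c.1) {c | c.1 0 = 0} Φ ?_ ?_ F ?_ ?_ ?_) ?_
  · rintro c - x hx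
    obtain ⟨z', hdim, hxz', hface⟩ := exists_face_of_mem_gridBoundary hx
    refine ⟨⟨z', hface.mem_gridDrum c.2⟩, hdim, hxz', supportedOn_mono ?_⟩
    refine Set.inter_subset_inter ?_ (hRanti _ _ hface.tail)
    by_cases hc : c.1 0 = 2
    · have : z' 0 = 2 := by
        rcases hface 0 with h0 | ⟨⟨b, hb⟩, h0⟩ <;> omega
      simp [hc, this]
    · simp [hc]
  · rintro c hc c' hc' hne x ⟨hx, hx'⟩
    refine (isGridFace_or_mem_gridBoundary hx hx').resolve_left fun hface => ?_
    rcases hc' with hc' | hc'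
    · have hc' : c'.1 0 = 0 := hc'
      refine hc (?_ : c.1 0 = 0)
      rcases hface 0 with h0 | ⟨⟨b, hb⟩, h0⟩ <;> omega
    · exact hne (Subtype.ext (hface.eq_of_gridDim_le hc').symm)
  · refine hf.comp (f := fun x : Fin (k + 1) → ℝ => (N : ℝ)⁻¹ • Fin.tail x)
      (Continuous.continuousOn ?_) fun x hx => ?_
    · exact (continuous_pi fun i : Fin k => continuous_apply i.succ).const_smul (N : ℝ)⁻¹
    · obtain ⟨c, hc, hx⟩ := Set.mem_iUnion₂.1 hx
      have hc : c.1 0 = 0 := hc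
      have := gridCell_subset_sphere (htop c (by omega)) (htail _ _ hx)
      rw [mem_sphere_zero_iff_norm] at this ⊢
      rw [norm_smul, this, norm_inv, Real.norm_of_nonneg hNR.le]
      exact inv_mul_cancel₀ hNR.ne'
  · intro c hc x hx q hq
    have hc : c.1 0 = 0 := hc
    have hc2 : ¬ c.1 0 = 2 := by omega
    refine ⟨by simp [hc2], ?_⟩
    rintro _ ⟨z₁, ⟨hz₁, hf₁⟩, rfl⟩
    exact (F x).2.2.1 _ _ hq (hp z₁ hz₁ _ (hf₁.gridCell_subset (htail _ _ hx)))
  · intro c hc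
    have hc : ¬ c.1 0 = 0 := hc
    by_cases hc2 : c.1 0 = 2
    · obtain ⟨hd1, hd2⟩ := gridDim_le_of_top (N := N) hc2
      simp only [Φ, if_pos hc2]
      by_cases hB : Fin.tail c.1 ∈ gridSphere (Fin k) N
      · have hd := hd2 hB
        by_cases hRQ : Disjoint (R (Fin.tail c.1)) Q
        · refine (hlink _ ?_ ⟨_, hRself _ hB⟩ (hRchain _ hB) hRQ).fillsSphere_supportedOn
            (by omega)
          exact Set.image_mono fun z hz => hz.1
        · obtain ⟨r, hr, hrQ⟩ := Set.not_disjoint_iff.1 hRQ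
          exact fillsSphere_supportedOn_of_comparable
            (Q := Q ∩ comparables (R (Fin.tail c.1))) (r := r) ⟨hrQ, hRchain _ hB r hr⟩
            (fun q hq => hq.2 r hr) _
      · have hR : comparables (R (Fin.tail c.1)) = Set.univ := by
          refine Set.eq_univ_of_forall fun q => ?_
          rintro _ ⟨z₁, ⟨hz₁, hf₁⟩, rfl⟩
          exact absurd (hf₁.mem_gridSphere hz₁) hB
        rw [hR, Set.inter_univ]
        exact hQ.fillsSphere_supportedOn (by omega)
    · have hB := htop c hc2
      simp only [Φ, if_neg hc2, Set.univ_inter]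
      exact fillsSphere_supportedOn_of_comparable
        (Q := comparables (R (Fin.tail c.1))) (r := p (Fin.tail c.1))
        (hRchain _ hB _ (hRself _ hB)) (fun q hq => hq _ (hRself _ hB)) _
  · rintro G ⟨hG, hGΦ, hGF⟩
    let θ : (Fin k → ℝ) → (Fin (k + 1) → ℝ) := fun x =>
      Fin.cons (min 1 (2 - 2 * ‖x‖)) ((N : ℝ) • (max (1 / 2) ‖x‖)⁻¹ • x)
    have hθ : Continuous θ := by
      refine Continuous.finCons ?_ ?_
      · fun_prop
      · have h1 : Continuous fun x : Fin k → ℝ => (max (1 / 2) ‖x‖)⁻¹ := by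
          refine Continuous.inv₀ (by fun_prop) fun x => ?_
          have : (1 / 2 : ℝ) ≤ max (1 / 2) ‖x‖ := le_max_left _ _
          linarith
        fun_prop
    have hmem : ∀ x ∈ Metric.closedBall (0 : Fin k → ℝ) 1,
        (fun i => ⌊θ x i⌋ + ⌈θ x i⌉) ∈ gridDrum k N := by
      intro x hx
      have hx : ‖x‖ ≤ 1 := by simpa using hx
      have hθ0 : θ x 0 = min 1 (2 - 2 * ‖x‖) := rfl
      have hθs : Fin.tail (θ x) = (N : ℝ) • (max (1 / 2) ‖x‖)⁻¹ • x := rfl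
      have hmax : (0 : ℝ) < max (1 / 2) ‖x‖ := lt_of_lt_of_le (by norm_num) (le_max_left _ _)
      have hn : ‖Fin.tail (θ x)‖ = N * ((max (1 / 2) ‖x‖)⁻¹ * ‖x‖) := by
        rw [hθs, norm_smul, norm_smul, Real.norm_of_nonneg hNR.le, norm_inv,
          Real.norm_of_nonneg hmax.le]
      have hn' : ‖Fin.tail (θ x)‖ ≤ N := by
        rw [hn]
        refine mul_le_of_le_one_right hNR.le ?_
        rw [inv_mul_le_iff₀ hmax, mul_one]
        exact le_max_right _ _
      refine ⟨⟨?_, ?_⟩, fun i => ?_, ?_⟩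
      · have : 0 ≤ θ x 0 := by rw [hθ0]; exact le_min zero_le_one (by linarith)
        have h1 : 0 ≤ ⌊θ x 0⌋ := Int.floor_nonneg.2 this
        have h2 : 0 ≤ ⌈θ x 0⌉ := Int.ceil_nonneg this
        positivity
      · have : θ x 0 ≤ 1 := min_le_left _ _
        have h1 : ⌈θ x 0⌉ ≤ 1 := Int.ceil_le.2 (by simpa using this)
        have h2 : ⌊θ x 0⌋ ≤ ⌈θ x 0⌉ := Int.floor_le_ceil _
        have h3 : ⌊θ x 0⌋ + ⌈θ x 0⌉ ≤ 2 := by omega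
        exact h3
      · exact abs_floor_add_ceil_le ((norm_le_pi_norm (Fin.tail (θ x)) i).trans hn')
      · rcases le_total ‖x‖ (1 / 2) with hle | hle
        · right
          have : θ x 0 = 1 := by rw [hθ0]; exact min_eq_left (by linarith)
          simp [this]
        · left
          refine floor_add_ceil_mem_gridSphere hN (x := Fin.tail (θ x)) ?_
          rw [hn, max_eq_right hle, inv_mul_cancel₀ (by linarith), mul_one]
    refine ⟨G ∘ θ, hG.comp hθ.continuousOn fun x hx => ?_, Set.mapsTo_univ _ _, fun x hx => ?_⟩
    · exact Set.mem_iUnion.2 ⟨⟨_, hmem x hx⟩, mem_gridCell_floor_add_ceil (θ x)⟩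
    · have hx' : ‖x‖ = 1 := by simpa using hx
      have hθ0 : θ x 0 = 0 := by
        change min 1 (2 - 2 * ‖x‖) = 0
        rw [hx']; norm_num
      have h1 : θ x ∈ ⋃ c ∈ {c : ι | c.1 0 = 0}, gridCell c.1 := by
        refine Set.mem_iUnion₂.2 ⟨⟨_, hmem x (Metric.sphere_subset_closedBall hx)⟩, ?_,
          mem_gridCell_floor_add_ceil (θ x)⟩
        simp [hθ0]
      rw [Function.comp_apply, hGF h1]
      change f ((N : ℝ)⁻¹ • (N : ℝ) • (max (1 / 2) ‖x‖)⁻¹ • x) = f x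
      rw [hx', inv_smul_smul₀ hNR.ne']
      norm_num

end LinkExtension

section SetLinks

variable {P : Type*} [PartialOrder P]

theorem PosetFills.image_iff {P' : Type*} [PartialOrder P'] (e : P ↪o P') (S : Set P) {D : ℤ} :
    PosetFills ↥(e '' S) D ↔ PosetFills S D := by
  let E : S ≃o ↥(e '' S) :=
    { Equiv.Set.image e S e.injective with
      map_rel_iff' := fun {a b} => e.le_iff_le }
  exact ⟨fun h => h.congr E.symm, fun h => h.congr E⟩

theorem PosetFills.of_links_subset {A B : Set P} {D : ℤ} (hAB : A ⊆ B) (hA : PosetFills A D)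
    (h : ∀ R ⊆ B \ A, R.Finite → R.Nonempty → (∀ r ∈ R, ∀ r' ∈ R, r ≤ r' ∨ r' ≤ r) →
      PosetFills ↥(A ∩ comparables R) (D - 1)) : PosetFills B D := by
  refine PosetFills.of_links fun S hS => ⟨Subtype.val ⁻¹' A, ?_, fun R hRS hRn hRc hRd => ?_⟩
  · rw [← PosetFills.image_iff (OrderEmbedding.subtype (· ∈ B))]
    have heq : OrderEmbedding.subtype (· ∈ B) '' (Subtype.val ⁻¹' A) = A :=
      (Subtype.image_preimage_coe B A).trans (Set.inter_eq_right.2 hAB)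
    rw [heq]
    exact hA
  · rw [← PosetFills.image_iff (OrderEmbedding.subtype (· ∈ B))]
    have := h (Subtype.val '' R) ?_ ((hS.subset hRS).image _) (hRn.image _) ?_
    · have heq : OrderEmbedding.subtype (· ∈ B) '' (Subtype.val ⁻¹' A ∩ comparables R) =
          A ∩ comparables (Subtype.val '' R) := by
        ext q
        constructor
        · rintro ⟨q, ⟨hq, hqR⟩, rfl⟩
          refine ⟨hq, ?_⟩
          rintro _ ⟨r, hr, rfl⟩
          exact hqR r hr
        · rintro ⟨hq, hqR⟩
          exact ⟨⟨q, hAB hq⟩, ⟨hq, fun r hr => hqR r.1 ⟨r, hr, rfl⟩⟩, rfl⟩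
      rw [heq]
      exact this
    · rintro _ ⟨r, hr, rfl⟩
      exact ⟨r.2, fun hrA => Set.disjoint_left.1 hRd hr hrA⟩
    · rintro _ ⟨r, hr, rfl⟩ _ ⟨r', hr', rfl⟩
      exact hRc r hr r' hr'

theorem PosetFills.iUnion {A : ℕ → Set P} {D : ℤ} (hA : ∀ r, PosetFills (A r) D)
    (hmono : Monotone A) : PosetFills ↥(⋃ r, A r) D := by
  refine PosetFills.of_links fun S hS => ?_
  obtain ⟨r, hr⟩ : ∃ r, ∀ p ∈ S, p.1 ∈ A r := by
    have hex : ∀ p : ↥(⋃ r, A r), ∃ r, p.1 ∈ A r := fun p => Set.mem_iUnion.1 p.2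
    choose r hr using hex
    obtain ⟨M, hM⟩ := (hS.image r).bddAbove
    exact ⟨M, fun p hp => hmono (hM ⟨p, hp, rfl⟩) (hr p)⟩
  refine ⟨Subtype.val ⁻¹' A r, ?_, fun R hRS hRn hRc hRd => ?_⟩
  · rw [← PosetFills.image_iff (OrderEmbedding.subtype (· ∈ ⋃ r, A r))]
    have heq : OrderEmbedding.subtype (· ∈ ⋃ r, A r) '' (Subtype.val ⁻¹' A r) = A r :=
      (Subtype.image_preimage_coe _ (A r)).trans
        (Set.inter_eq_right.2 (Set.subset_iUnion A r))
    rw [heq]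
    exact hA r
  · obtain ⟨p, hp⟩ := hRn
    exact absurd (hr p (hRS hp)) (Set.disjoint_left.1 hRd hp)

theorem exists_max_of_chain {R : Set P} (hR : R.Finite) (hn : R.Nonempty)
    (hc : ∀ r ∈ R, ∀ r' ∈ R, r ≤ r' ∨ r' ≤ r) : ∃ m ∈ R, ∀ r ∈ R, r ≤ m := by
  obtain ⟨m, hm⟩ := hR.exists_maximal hn
  refine ⟨m, hm.1, fun r hr => ?_⟩
  rcases hc r hr m hm.1 with h | h
  · exact h
  · exact hm.2 hr h

theorem exists_min_of_chain {R : Set P} (hR : R.Finite) (hn : R.Nonempty)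
    (hc : ∀ r ∈ R, ∀ r' ∈ R, r ≤ r' ∨ r' ≤ r) : ∃ m ∈ R, ∀ r ∈ R, m ≤ r := by
  obtain ⟨m, hm⟩ := hR.exists_minimal hn
  refine ⟨m, hm.1, fun r hr => ?_⟩
  rcases hc m hm.1 r hr with h | h
  · exact h
  · exact hm.2 hr h

/-- A set in which some element has a least upper bound with every other one is contractible. -/
theorem PosetFills.of_joins {Q : Set P} {q₀ : P} (hq₀ : q₀ ∈ Q)
    (h : ∀ q ∈ Q, ∃ m ∈ Q, q ≤ m ∧ q₀ ≤ m ∧ ∀ m' ∈ Q, q ≤ m' → q₀ ≤ m' → m ≤ m') (D : ℤ) :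
    PosetFills Q D := by
  refine PosetFills.of_links_subset (A := {y ∈ Q | q₀ ≤ y}) (fun y hy => hy.1)
    (PosetFills.of_comparable (q := ⟨q₀, hq₀, le_rfl⟩) (fun p => Or.inr p.2.2) D)
    fun R hR hfin hne hch => ?_
  obtain ⟨r, hr, hmax⟩ := exists_max_of_chain hfin hne hch
  obtain ⟨m, hmQ, hrm, hqm, hm⟩ := h r (hR hr).1
  refine PosetFills.of_comparable
    (q := ⟨m, ⟨hmQ, hqm⟩, fun r' hr' => Or.inr ((hmax r' hr').trans hrm)⟩) (fun p => Or.inr ?_) _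
  obtain ⟨y, ⟨hyQ, hy⟩, hyR⟩ := p
  refine hm y hyQ ?_ hy
  rcases hyR r hr with h' | h'
  · exact absurd ⟨(hR hr).1, hy.trans h'⟩ (hR hr).2
  · exact h'

end SetLinks

section Words

variable {V : Type*}

theorem List.Sublist.dropWhile_sublist {p : V → Bool} {l₁ l₂ : List V} (h : l₁.Sublist l₂) :
    (l₁.dropWhile p).Sublist (l₂.dropWhile p) := by
  induction h with
  | slnil => exact List.Sublist.refl _
  | @cons l₁ l₂ a h ih =>
    rw [List.dropWhile_cons]
    split_ifs
    · exact ih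
    · exact ((List.dropWhile_sublist p).trans h).cons _
  | @cons_cons l₁ l₂ a h ih =>
    rw [List.dropWhile_cons, List.dropWhile_cons]
    split_ifs
    · exact ih
    · exact h.cons_cons a

/-- The word with given list of letters. -/
def OSeq.of (l : List V) (hl : l ≠ [] ∧ l.Nodup) : OSeq V := ⟨l, hl⟩

theorem OSeq.lt_iff {a b : OSeq V} : a < b ↔ a.1.Sublist b.1 ∧ a.1 ≠ b.1 :=
  lt_iff_le_and_ne.trans (and_congr_right fun _ => not_congr Subtype.ext_iff)

/-- The one-letter word. -/
def OSeq.singleton (x : V) : OSeq V := ⟨[x], by simp⟩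

theorem OSeq.singleton_le {x : V} {u : OSeq V} : OSeq.singleton x ≤ u ↔ x ∈ u.1 :=
  List.singleton_sublist

/-- The case of `q ∨ [x]` for subwords of a word beginning with `x`. -/
theorem cons_sublist_of_sublist_of_mem {x : V} {y q m : List V} (hnd : (x :: y).Nodup)
    (hm : m.Sublist (x :: y)) (hxm : x ∈ m) (hq : q.Sublist m) (hxq : x ∉ q) :
    (x :: q).Sublist m := by
  rcases List.sublist_cons_iff.1 hm with h | ⟨m', rfl, h⟩
  · exact absurd (h.subset hxm) (List.nodup_cons.1 hnd).1
  · rcases List.sublist_cons_iff.1 hq with h' | ⟨q', rfl, h'⟩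
    · exact h'.cons_cons x
    · simp at hxq

theorem sublist_tail_of_notMem {x : V} {y q : List V} (hq : q.Sublist (x :: y)) (hxq : x ∉ q) :
    q.Sublist y := by
  rcases List.sublist_cons_iff.1 hq with h | ⟨q', rfl, h⟩
  · exact h
  · simp at hxq

theorem OSeq.le_of_lt_cons {x : V} {y : OSeq V} {q : OSeq V} (hq : q.1.Sublist (x :: y.1))
    (hne : q.1 ≠ x :: y.1) (hyq : y ≤ q) : q = y := by
  refine (Subtype.ext (List.Sublist.eq_of_length_le hyq ?_)).symm
  have h1 := hq.length_le
  have h2 : q.1.length ≠ (x :: y.1).length := fun h => hne (hq.eq_of_length h)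
  simp only [List.length_cons] at h1 h2
  omega

/-- The join of the boundary of a simplex and a highly connected set. -/
theorem PosetFills.boundary_union {u : OSeq V} {Z : Set (OSeq V)} (hZ : ∀ z ∈ Z, u ≤ z) {n : ℤ}
    (h : PosetFills Z n) (v : OSeq V) (hv : v ≤ u) :
    PosetFills ↥({q | q < v} ∪ Z) (n + v.1.length - 1) := by
  suffices H : ∀ (l : List V) (hl : l ≠ [] ∧ l.Nodup), OSeq.of l hl ≤ u →
      PosetFills ↥({q | q < OSeq.of l hl} ∪ Z) (n + l.length - 1) from H v.1 v.2 hv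
  clear hv v
  intro l hl hv
  induction l with
  | nil => exact absurd rfl hl.1
  | cons x y ih =>
    rcases y with - | ⟨x', y⟩
    · have : {q | q < OSeq.of [x] hl} ∪ Z = Z := by
        rw [Set.union_eq_right]
        intro q hq
        have h1 : q.1.Sublist [x] := (OSeq.lt_iff.1 hq).1
        rcases List.sublist_singleton.1 h1 with h2 | h2
        · exact absurd h2 q.2.1
        · exact absurd h2 (OSeq.lt_iff.1 hq).2
      rw [this]
      exact h.mono (by simp)
    · set y' := x' :: y with hy'
      have hy : y' ≠ [] ∧ y'.Nodup := ⟨by simp [hy'], (List.nodup_cons.1 hl.2).2⟩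
      have hxy : x ∉ y' := (List.nodup_cons.1 hl.2).1
      have hyv : OSeq.of y' hy ≤ OSeq.of (x :: y') hl := List.sublist_cons_self _ _
      let A : Set (OSeq V) := ({q | q < OSeq.of (x :: y') hl} ∪ Z) \ {OSeq.of y' hy}
      have hxu : x ∈ u.1 := List.Sublist.subset hv List.mem_cons_self
      have hyZ : OSeq.of y' hy ∉ Z := fun hz => by
        have := List.Sublist.length_le (hv.trans (hZ _ hz))
        simp [OSeq.of, hy'] at this
      have hltmem : ∀ q : OSeq V, q.1.Sublist (x :: y') → q.1 ≠ x :: y' → q.1 ≠ y' → q ∈ A :=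
        fun q h1 h2 h3 => ⟨Or.inl (OSeq.lt_iff.2 ⟨h1, h2⟩),
          fun he => h3 (congrArg Subtype.val he)⟩
      have hsing : OSeq.singleton x ∈ A := by
        refine hltmem _ (by simp [OSeq.singleton]) (by simp [OSeq.singleton, hy']) ?_
        rintro he
        exact hxy (he ▸ List.mem_singleton.2 rfl)
      have hA : ∀ D, PosetFills A D := by
        refine PosetFills.of_joins hsing fun q hq => ?_
        by_cases hxq : x ∈ q.1
        · exact ⟨q, hq, le_rfl, OSeq.singleton_le.2 hxq, fun m' _ h1 _ => h1⟩
        · obtain ⟨hq1 | hq1, hq2⟩ := hq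
          · have hqs : q.1.Sublist y' := sublist_tail_of_notMem (OSeq.lt_iff.1 hq1).1 hxq
            have hq3 : q.1 ≠ y' := fun he => hq2 (Subtype.ext he)
            refine ⟨OSeq.of (x :: q.1) ⟨by simp, List.nodup_cons.2 ⟨hxq, q.2.2⟩⟩,
              hltmem _ (hqs.cons_cons x)
              (fun he => hq3 (List.cons_injective he)) ?_, List.sublist_cons_self _ _,
              OSeq.singleton_le.2 List.mem_cons_self, fun m' hm' h1 h2 => ?_⟩
            · rintro he
              exact hxy (he ▸ List.mem_cons_self)
            · rw [OSeq.singleton_le] at h2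
              obtain ⟨hm1 | hm1, -⟩ := hm'
              · exact cons_sublist_of_sublist_of_mem hl.2 (OSeq.lt_iff.1 hm1).1 h2 h1 hxq
              · exact List.Sublist.trans (hqs.cons_cons x) (hv.trans (hZ _ hm1))
          · exact absurd (List.Sublist.subset (hZ _ hq1) hxu) hxq
      refine PosetFills.of_links_subset (A := A) Set.sdiff_subset (hA _) fun R hR hfin hne hch => ?_
      have hRy : R = {OSeq.of y' hy} := by
        refine Set.eq_singleton_iff_nonempty_unique_mem.2 ⟨hne, fun r hr => ?_⟩
        obtain ⟨h1, h2⟩ := hR hr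
        by_contra h3
        exact h2 ⟨h1, h3⟩
      have hlink : A ∩ comparables R = {q | q < OSeq.of y' hy} ∪ Z := by
        rw [hRy]
        ext q
        constructor
        · rintro ⟨⟨hq1 | hq1, hq2⟩, hqc⟩
          · rcases hqc _ rfl with h1 | h1
            · exact Or.inl (lt_of_le_of_ne h1 hq2)
            · exact absurd (OSeq.le_of_lt_cons (y := OSeq.of y' hy) (OSeq.lt_iff.1 hq1).1
                (OSeq.lt_iff.1 hq1).2 h1) hq2
          · exact Or.inr hq1
        · rintro (hq | hq)
          · refine ⟨⟨Or.inl (lt_of_lt_of_le hq hyv), fun he => hq.ne he⟩, ?_⟩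
            rintro _ rfl
            exact Or.inl hq.le
          · refine ⟨⟨Or.inr hq, fun he => hyZ (he ▸ hq)⟩, ?_⟩
            rintro _ rfl
            exact Or.inr (hyv.trans (hv.trans (hZ _ hq)))
      rw [hlink]
      refine (ih hy (hyv.trans hv)).mono ?_
      simp only [hy', List.length_cons]
      push_cast
      omega

end Words

theorem PosetFills.of_surjective {P P' : Type*} [PartialOrder P] [PartialOrder P'] {D : ℤ}
    (h : PosetFills P D) (f : P → P') (hf : ∀ a b, f a ≤ f b ↔ a ≤ b)
    (hs : Function.Surjective f) : PosetFills P' D :=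
  h.congr (RelIso.ofSurjective (OrderEmbedding.ofMapLEIff f hf) hs)

section Words

variable {V : Type*}

open Classical in
/-- The part of a word that remains after deleting the longest prefix with letters in `X`. -/
noncomputable def dropPrefix (X : Set V) (l : List V) : List V := l.dropWhile (· ∈ X)

theorem dropPrefix_sublist (X : Set V) (l : List V) : (dropPrefix X l).Sublist l :=
  List.dropWhile_sublist _

theorem dropPrefix_mono (X : Set V) {l l' : List V} (h : l.Sublist l') :
    (dropPrefix X l).Sublist (dropPrefix X l') :=
  h.dropWhile_sublist

theorem dropPrefix_append {X : Set V} {w : List V} (hw : ∀ x ∈ w, x ∈ X) (l : List V) :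
    dropPrefix X (w ++ l) = dropPrefix X l :=
  List.dropWhile_append_of_pos (by simpa using hw)

theorem dropPrefix_cons_of_mem {X : Set V} {x : V} (hx : x ∈ X) (l : List V) :
    dropPrefix X (x :: l) = dropPrefix X l := by
  simp [dropPrefix, hx]

theorem dropPrefix_cons_of_notMem {X : Set V} {x : V} (hx : x ∉ X) (l : List V) :
    dropPrefix X (x :: l) = x :: l := by
  simp [dropPrefix, hx]

theorem exists_append_dropPrefix (X : Set V) (l : List V) :
    ∃ w, (∀ x ∈ w, x ∈ X) ∧ l = w ++ dropPrefix X l := by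
  classical
  refine ⟨l.takeWhile (· ∈ X), fun x hx => ?_, ?_⟩
  · simpa using List.mem_takeWhile_imp hx
  · exact List.takeWhile_append_dropWhile.symm

theorem dropPrefix_eq_nil {X : Set V} {l : List V} : dropPrefix X l = [] ↔ ∀ x ∈ l, x ∈ X := by
  simp [dropPrefix]

/-- The words in `F` whose tail has length at most `r` or lies in `T₀`. -/
def tailFiltration (F : Set (OSeq V)) (X : Set V) (T₀ : Set (List V)) (r : ℕ) : Set (OSeq V) :=
  {u | u ∈ F ∧ ((dropPrefix X u.1).length ≤ r ∨ dropPrefix X u.1 ∈ T₀)}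

variable {F : Set (OSeq V)} {X : Set V} {T₀ : Set (List V)} {D : ℤ}

theorem dropPrefix_eq_of_le_tailFiltration (hT₀ : ∀ l ∈ T₀, l.length ≤ 1) {r : ℕ} {q : OSeq V}
    {l : List V} (hl : l.length = r + 1) (hq : q ∈ tailFiltration F X T₀ r)
    (hlq : l.Sublist (dropPrefix X q.1)) : l ∈ T₀ := by
  have hlen := hlq.length_le
  rcases hq.2 with h | h
  · omega
  · have := hT₀ _ h
    rwa [hlq.eq_of_length (by omega)]

theorem PosetFills.tailFiltration_union (hF : ChainCondition F) (hT₀ : ∀ l ∈ T₀, l.length ≤ 1)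
    {r : ℕ} (h : PosetFills (tailFiltration F X T₀ r) D) :
    PosetFills ↥(tailFiltration F X T₀ r ∪
      {u | u ∈ F ∧ (dropPrefix X u.1).length = r + 1 ∧ dropPrefix X u.1 ≠ u.1}) D := by
  refine h.of_links_subset Set.subset_union_left fun R hR hfin hne hch => ?_
  obtain ⟨u, hu, hmin⟩ := exists_min_of_chain hfin hne hch
  obtain ⟨huF, hul, hut⟩ := (hR hu).1.resolve_left (hR hu).2
  have huT : dropPrefix X u.1 ∉ T₀ := fun hc => (hR hu).2 ⟨huF, Or.inr hc⟩
  obtain ⟨x, y, hxy⟩ := List.exists_cons_of_ne_nil u.2.1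
  have hx : x ∈ X := by
    by_contra hx
    rw [hxy, dropPrefix_cons_of_notMem hx] at hut
    exact hut rfl
  have hnd : (x :: y).Nodup := hxy ▸ u.2.2
  have hle : ∀ q ∈ tailFiltration F X T₀ r ∩ comparables R, q.1.Sublist (x :: y) := by
    rintro q ⟨hq, hqR⟩
    rcases hqR u hu with h' | h'
    · exact hxy ▸ h'
    · exact absurd (dropPrefix_eq_of_le_tailFiltration hT₀ hul hq (dropPrefix_mono X h')) huT
  have hmem : ∀ q : OSeq V, (dropPrefix X q.1).length ≤ r ∨ dropPrefix X q.1 ∈ T₀ →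
      q.1.Sublist (x :: y) → q ∈ tailFiltration F X T₀ r ∩ comparables R := by
    intro q hq hqs
    have hqu : q ≤ u := by
      change q.1.Sublist u.1
      rwa [hxy]
    exact ⟨⟨hF hqu huF, hq⟩, fun r hr => Or.inl (hqu.trans (hmin r hr))⟩
  refine PosetFills.of_joins (q₀ := OSeq.singleton x) (hmem _ (Or.inl ?_) ?_) (fun q hq => ?_) _
  · simp [OSeq.singleton, dropPrefix_cons_of_mem hx, dropPrefix_eq_nil.2]
  · simp [OSeq.singleton]
  · by_cases hxq : x ∈ q.1
    · exact ⟨q, hq, le_rfl, OSeq.singleton_le.2 hxq, fun m' _ h1 _ => h1⟩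
    · refine ⟨OSeq.of (x :: q.1) ⟨by simp, List.nodup_cons.2 ⟨hxq, q.2.2⟩⟩, hmem _ ?_ ?_,
        List.sublist_cons_self _ _, OSeq.singleton_le.2 List.mem_cons_self, fun m' hm' h1 h2 => ?_⟩
      · change (dropPrefix X (x :: q.1)).length ≤ r ∨ dropPrefix X (x :: q.1) ∈ T₀
        rw [dropPrefix_cons_of_mem hx]
        exact hq.1.2
      · exact (sublist_tail_of_notMem (hle q hq) hxq).cons_cons x
      · exact cons_sublist_of_sublist_of_mem hnd (hle m' hm') (OSeq.singleton_le.1 h2) h1 hxq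

/-- The words over `X` that can be put in front of `u` without leaving `F`. -/
def prefixWords (F : Set (OSeq V)) (X : Set V) (u : List V) : Set (OSeq V) :=
  {w | w ∈ SeqIn X ∧ ∃ h, OSeq.of (w.1 ++ u) h ∈ F}

theorem PosetFills.append_prefixWords {u : List V} (h : PosetFills (prefixWords F X u) D) :
    PosetFills {z : OSeq V | z ∈ F ∧ ∃ w ∈ SeqIn X, z.1 = w.1 ++ u} D := by
  refine h.of_surjective (fun w => ⟨OSeq.of (w.1.1 ++ u) w.2.2.1, w.2.2.2, w.1, w.2.1, rfl⟩)
    (fun a b => List.append_sublist_append_right u) ?_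
  rintro ⟨z, hz, w, hw, hzw⟩
  have hz' : z = OSeq.of (w.1 ++ u) (hzw ▸ z.2) := Subtype.ext hzw
  exact ⟨⟨w, hw, hzw ▸ z.2, hz' ▸ hz⟩, Subtype.ext hz'.symm⟩

theorem PosetFills.tailFiltration_succ (hF : ChainCondition F) (hT₀ : ∀ l ∈ T₀, l.length ≤ 1)
    (h1 : ∀ u ∈ F, dropPrefix X u.1 = u.1 → u.1 ∉ T₀ →
      PosetFills (prefixWords F X u.1) (D - u.1.length))
    {r : ℕ} (h : PosetFills (tailFiltration F X T₀ r) D) :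
    PosetFills (tailFiltration F X T₀ (r + 1)) D := by
  refine (h.tailFiltration_union hF hT₀).of_links_subset ?_ fun R hR hfin hne hch => ?_
  · rintro q (hq | ⟨hqF, hq, -⟩)
    · exact ⟨hq.1, hq.2.imp_left fun hle => hle.trans (Nat.le_succ r)⟩
    · exact ⟨hqF, Or.inl hq.le⟩
  have key : ∀ u ∈ R, u ∈ F ∧ u.1.length = r + 1 ∧ dropPrefix X u.1 = u.1 ∧ u.1 ∉ T₀ := by
    intro u hu
    obtain ⟨⟨huF, hul⟩, hun⟩ := hR hu
    have hT : dropPrefix X u.1 ∉ T₀ := fun hc => hun (Or.inl ⟨huF, Or.inr hc⟩)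
    have hlen : (dropPrefix X u.1).length = r + 1 := by
      refine le_antisymm (hul.resolve_right hT) ?_
      by_contra hc
      exact hun (Or.inl ⟨huF, Or.inl (by omega)⟩)
    have heq : dropPrefix X u.1 = u.1 := by
      by_contra hc
      exact hun (Or.inr ⟨huF, hlen, hc⟩)
    exact ⟨huF, heq ▸ hlen, heq, heq ▸ hT⟩
  obtain ⟨u, hu⟩ := hne
  obtain ⟨huF, hul, hut, huT⟩ := key u hu
  have hRu : R = {u} := by
    refine Set.eq_singleton_iff_unique_mem.2 ⟨hu, fun u' hu' => Subtype.ext ?_⟩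
    have hl' := (key u' hu').2.1
    rcases hch u' hu' u hu with h' | h'
    · exact List.Sublist.eq_of_length h' (hl'.trans hul.symm)
    · exact (List.Sublist.eq_of_length h' (hul.trans hl'.symm)).symm
  subst hRu
  have hlink : (tailFiltration F X T₀ r ∪
      {u | u ∈ F ∧ (dropPrefix X u.1).length = r + 1 ∧ dropPrefix X u.1 ≠ u.1}) ∩
      comparables {u} = {q | q < u} ∪ {z : OSeq V | z ∈ F ∧ ∃ w ∈ SeqIn X, z.1 = w.1 ++ u.1} := by
    ext q
    constructor
    · rintro ⟨hq, hqu⟩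
      rcases hqu u rfl with hle | hle
      · refine Or.inl (lt_of_le_of_ne hle ?_)
        rintro rfl
        exact (hR hu).2 hq
      · right
        have hsub : u.1.Sublist (dropPrefix X q.1) := by
          have := dropPrefix_mono X hle
          rwa [hut] at this
        rcases hq with hq | ⟨hqF, hql, hqt⟩
        · exact absurd (dropPrefix_eq_of_le_tailFiltration hT₀ hul hq hsub) huT
        · obtain ⟨w, hwX, hw⟩ := exists_append_dropPrefix X q.1
          rw [← hsub.eq_of_length (hul.trans hql.symm)] at hw hqt
          refine ⟨hqF, OSeq.of w ⟨?_, ?_⟩, hwX, hw⟩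
          · rintro rfl
            exact hqt hw.symm
          · exact (List.nodup_append.1 (hw ▸ q.2.2)).1
    · rintro (hq | ⟨hqF, w, hwX, hw⟩)
      · have hqs := OSeq.lt_iff.1 hq
        refine ⟨Or.inl ⟨hF hq.le huF, Or.inl ?_⟩, ?_⟩
        · have h1 := (dropPrefix_sublist X q.1).length_le
          have h2 := hqs.1.length_le
          have h3 : q.1.length ≠ u.1.length := fun he => hqs.2 (hqs.1.eq_of_length he)
          omega
        · rintro _ hr
          exact Or.inl (Set.mem_singleton_iff.1 hr ▸ hq.le)
      · have hdq : dropPrefix X q.1 = u.1 := by rw [hw, dropPrefix_append hwX, hut]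
        refine ⟨Or.inr ⟨hqF, hdq ▸ hul, ?_⟩, ?_⟩
        · rw [hdq, hw]
          intro hc
          exact w.2.1 (List.self_eq_append_left.1 hc)
        · rintro _ hr
          rw [Set.mem_singleton_iff.1 hr]
          refine Or.inr ?_
          change u.1.Sublist q.1
          rw [hw]
          exact List.sublist_append_right _ _
  rw [hlink]
  refine (PosetFills.boundary_union ?_ (h1 u huF hut huT).append_prefixWords u le_rfl).mono
    (by omega)
  rintro z ⟨-, w, -, hw⟩
  change u.1.Sublist z.1
  rw [hw]
  exact List.sublist_append_right _ _

theorem PosetFills.of_tailFiltration (hF : ChainCondition F) (hT₀ : ∀ l ∈ T₀, l.length ≤ 1)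
    (h0 : PosetFills (tailFiltration F X T₀ 0) D)
    (h1 : ∀ u ∈ F, dropPrefix X u.1 = u.1 → u.1 ∉ T₀ →
      PosetFills (prefixWords F X u.1) (D - u.1.length)) : PosetFills F D := by
  have hA : ∀ r, PosetFills (tailFiltration F X T₀ r) D := fun r => by
    induction r with
    | zero => exact h0
    | succ r ih => exact PosetFills.tailFiltration_succ hF hT₀ h1 ih
  have hU : ⋃ r, tailFiltration F X T₀ r = F := by
    ext u
    rw [Set.mem_iUnion]
    exact ⟨fun ⟨r, hr⟩ => hr.1, fun hu => ⟨_, hu, Or.inl le_rfl⟩⟩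
  have := PosetFills.iUnion hA fun r r' hr u (hu : u ∈ tailFiltration F X T₀ r) =>
    (⟨hu.1, hu.2.imp_left fun h => h.trans hr⟩ : u ∈ tailFiltration F X T₀ r')
  rwa [hU] at this

/-- Connectivity of a set of words from that of the words over `X`. -/
theorem PosetFills.of_seqIn (hF : ChainCondition F) (h0 : PosetFills ↥(F ∩ SeqIn X) D)
    (h1 : ∀ u ∈ F, (∀ x ∈ u.1.head?, x ∉ X) →
      PosetFills (prefixWords F X u.1) (D - u.1.length)) : PosetFills F D := by
  refine PosetFills.of_tailFiltration (X := X) (T₀ := ∅) hF (by simp) ?_ fun u hu hut _ =>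
    h1 u hu ?_
  · have : tailFiltration F X ∅ 0 = F ∩ SeqIn X := by
      ext u
      simp [tailFiltration, SeqIn, dropPrefix_eq_nil]
    rwa [this]
  · intro x hx hxX
    obtain ⟨y, hy⟩ := List.head?_eq_some_iff.1 hx
    rw [hy, dropPrefix_cons_of_mem hxX] at hut
    have := (dropPrefix_sublist X y).length_le
    simp [hut] at this

/-- Connectivity of a set of words in which all words over `X` can be followed by `y`. -/
theorem PosetFills.of_seqIn_cone (hF : ChainCondition F) {y : V} (hy : y ∉ X)
    (hyF : OSeq.singleton y ∈ F)
    (h0 : ∀ w ∈ F ∩ SeqIn X, ∃ h, OSeq.of (w.1 ++ [y]) h ∈ F)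
    (h1 : ∀ u ∈ F, (∀ x ∈ u.1.head?, x ∉ X) →
      PosetFills (prefixWords F X u.1) (D - u.1.length)) : PosetFills F D := by
  refine PosetFills.of_tailFiltration (X := X) (T₀ := {[y]}) hF
    (fun l hl => by simp [Set.mem_singleton_iff.1 hl]) ?_ fun u hu hut _ => h1 u hu ?_
  · have hsing : dropPrefix X [y] = [y] := dropPrefix_cons_of_notMem hy _
    have hmem : ∀ u : OSeq V, u ∈ tailFiltration F X {[y]} 0 → y ∉ u.1 → ∀ x ∈ u.1, x ∈ X := by
      rintro u ⟨-, hu⟩ hyu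
      simp only [Nat.le_zero, List.length_eq_zero_iff, dropPrefix_eq_nil,
        Set.mem_singleton_iff] at hu
      refine hu.resolve_right fun hc => hyu ?_
      exact (dropPrefix_sublist X u.1).subset (hc ▸ List.mem_singleton.2 rfl)
    refine PosetFills.of_joins (q₀ := OSeq.singleton y) (D := D) ?_ (fun q hq => ?_)
    · exact ⟨hyF, Or.inr hsing⟩
    by_cases hyq : y ∈ q.1
    · exact ⟨q, hq, le_rfl, OSeq.singleton_le.2 hyq, fun m' _ h1 _ => h1⟩
    · have hqX := hmem q hq hyq
      obtain ⟨h, hF'⟩ := h0 q ⟨hq.1, hqX⟩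
      refine ⟨_, ⟨hF', Or.inr ?_⟩, List.sublist_append_left _ _, OSeq.singleton_le.2 ?_, ?_⟩
      · change dropPrefix X (q.1 ++ [y]) = [y]
        rw [dropPrefix_append hqX, hsing]
      · simp [OSeq.of]
      · rintro m ⟨hmF, hm⟩ h1 h2
        change (q.1 ++ [y]).Sublist m.1
        rw [OSeq.singleton_le] at h2
        obtain ⟨w, hwX, hw⟩ := exists_append_dropPrefix X m.1
        simp only [Nat.le_zero, List.length_eq_zero_iff, dropPrefix_eq_nil,
          Set.mem_singleton_iff] at hm
        rcases hm with hm | hm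
        · exact absurd (hm y h2) hy
        · rw [hm] at hw
          rw [hw]
          have h3 : q.1.Sublist (w ++ [y]) := hw ▸ h1
          obtain ⟨l₁, l₂, hl, hs1, hs2⟩ := List.sublist_append_iff.1 h3
          have : l₂ = [] := by
            rcases List.sublist_singleton.1 hs2 with h | h
            · exact h
            · exact absurd (by rw [hl, h]; simp) hyq
          rw [hl, this, List.append_nil]
          exact (List.append_sublist_append_right _).2 hs1
  · intro x hx hxX
    obtain ⟨y, hy⟩ := List.head?_eq_some_iff.1 hx
    rw [hy, dropPrefix_cons_of_mem hxX] at hut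
    have := (dropPrefix_sublist X y).length_le
    simp [hut] at this

end Words

section Nerve

open CategoryTheory Opposite Simplicial

variable {P : Type} [PartialOrder P]

/-- The simplex of the realization of the nerve spanned by a chain. -/
noncomputable def nerveCell {n : ℕ} (τ : Fin (n + 1) →o P) :
    C(stdSimplex ℝ (Fin (n + 1)), SSet.toTop.obj (nerve P)) :=
  TopCat.toSSetObjEquiv _ (op ⦋n⦌)
    ((sSetTopAdj.unit.app (nerve P)).app (op ⦋n⦌) τ.monotone.functor)

theorem nerveCell_comp {n m : ℕ} (τ : Fin (n + 1) →o P) (θ : Fin (m + 1) →o Fin (n + 1))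
    (t : stdSimplex ℝ (Fin (m + 1))) :
    nerveCell (τ.comp θ) t = nerveCell τ (stdSimplex.map θ t) := by
  let f : ⦋m⦌ ⟶ ⦋n⦌ := SimplexCategory.mkHom θ
  have h := ConcreteCategory.congr_hom ((sSetTopAdj.unit.app (nerve P)).naturality f.op)
    τ.monotone.functor
  exact congrArg (fun c => TopCat.toSSetObjEquiv _ (op ⦋m⦌) c t) h

/-- The morphism from the nerve to the singular simplicial set of the order realization. -/
noncomputable def nerveToSingular :
    nerve P ⟶ TopCat.toSSet.obj (TopCat.of (OrderRealization P)) where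
  app n := ↾fun σ : ComposableArrows P n.unop.len =>
    (TopCat.toSSetObjEquiv (TopCat.of (OrderRealization P)) n).symm
      ⟨OrderRealization.push σ.obj
        (fun i j => (le_total i j).imp (fun h => σ.monotone h) (fun h => σ.monotone h)),
      OrderRealization.continuous_push _ _⟩
  naturality := by
    intro m n f
    ext σ
    apply (TopCat.toSSetObjEquiv (TopCat.of (OrderRealization P)) n).injective
    ext1 t
    let σ' : ComposableArrows P m.unop.len := σ
    exact (OrderRealization.push_map (σ := σ'.obj)
      (hσ := fun i j => (le_total i j).imp (fun h => σ'.monotone h) (fun h => σ'.monotone h))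
      (SimplexCategory.Hom.toOrderHom f.unop) t).symm

/-- The comparison map from the simplicial realization of the nerve. -/
noncomputable def nerveToOrderRealization :
    SSet.toTop.obj (nerve P) ⟶ TopCat.of (OrderRealization P) :=
  (sSetTopAdj.homEquiv (nerve P) (TopCat.of (OrderRealization P))).symm nerveToSingular

theorem nerveToOrderRealization_nerveCell {n : ℕ} (τ : Fin (n + 1) →o P)
    (t : stdSimplex ℝ (Fin (n + 1))) :
    nerveToOrderRealization (nerveCell τ t) =
      OrderRealization.push τ
        (fun i j => (le_total i j).imp (fun h => τ.monotone h) (fun h => τ.monotone h)) t := by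
  have h := Equiv.apply_symm_apply
    (sSetTopAdj.homEquiv (nerve P) (TopCat.of (OrderRealization P))) nerveToSingular
  rw [Adjunction.homEquiv_unit] at h
  have h1 := ConcreteCategory.congr_hom (NatTrans.congr_app h (op ⦋n⦌)) τ.monotone.functor
  exact congrArg (fun c => TopCat.toSSetObjEquiv _ (op ⦋n⦌) c t) h1

theorem exists_orderHom_range_eq {Q : Type*} [PartialOrder Q] {C : Finset Q}
    (hC : ∀ i j : C, i.1 ≤ j.1 ∨ j.1 ≤ i.1) (hne : C.Nonempty) :
    ∃ (n : ℕ) (σ : Fin (n + 1) →o Q), StrictMono σ ∧ Set.range σ = C := by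
  classical
  let _ : LinearOrder C :=
    { (inferInstance : PartialOrder C) with
      le_total := hC
      toDecidableLE := Classical.decRel _ }
  have hcard : Fintype.card C = (C.card - 1) + 1 := by
    rw [Fintype.card_coe]
    have := hne.card_pos
    omega
  let e : Fin (C.card - 1 + 1) ≃o C := (Fintype.orderIsoFinOfCardEq C hcard)
  refine ⟨C.card - 1, ⟨fun i => (e i).1, fun i j h => e.monotone h⟩, fun i j h => ?_, ?_⟩
  · exact e.strictMono h
  · ext q
    constructor
    · rintro ⟨i, rfl⟩
      exact (e i).2
    · intro hq
      exact ⟨e.symm ⟨q, hq⟩, congrArg Subtype.val (e.apply_symm_apply ⟨q, hq⟩)⟩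

theorem exists_comp_eq_of_range_subset {n m : ℕ} {σ : Fin (n + 1) →o P} (hσ : StrictMono σ)
    (τ : Fin (m + 1) →o P) (h : Set.range τ ⊆ Set.range σ) :
    ∃ θ : Fin (m + 1) →o Fin (n + 1), σ.comp θ = τ := by
  choose θ hθ using fun i => h ⟨i, rfl⟩
  refine ⟨⟨θ, fun i j hij => ?_⟩, OrderHom.ext _ _ (funext hθ)⟩
  rw [← hσ.le_iff_le, hθ, hθ]
  exact τ.monotone hij

theorem OrderHom.isChain_fin {n : ℕ} (τ : Fin (n + 1) →o P) (i j : Fin (n + 1)) :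
    τ i ≤ τ j ∨ τ j ≤ τ i :=
  (le_total i j).imp (fun h => τ.monotone h) (fun h => τ.monotone h)

theorem exists_map_eq {n : ℕ} (t : stdSimplex ℝ (Fin (n + 1))) :
    ∃ (m : ℕ) (δ : Fin (m + 1) →o Fin (n + 1)) (t' : stdSimplex ℝ (Fin (m + 1))),
      stdSimplex.map δ t' = t ∧ ∀ i, t (δ i) ≠ 0 := by
  classical
  have hne : (Finset.univ.filter fun i => t i ≠ 0).Nonempty := by
    by_contra! h
    have h1 := t.2.2
    rw [Finset.sum_eq_zero] at h1
    · exact zero_ne_one h1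
    · intro i _
      by_contra hi
      exact (Finset.eq_empty_iff_forall_notMem.1 h) i (Finset.mem_filter.2 ⟨Finset.mem_univ i, hi⟩)
  obtain ⟨m, δ, hδ, hr⟩ := exists_orderHom_range_eq (fun i j => le_total i.1 j.1) hne
  have hmem : ∀ i, t i ≠ 0 ↔ i ∈ Set.range δ := fun i => by simp [hr]
  have hsum : ∀ i, (∑ j, if δ j = i then t (δ j) else 0) = t i := by
    intro i
    by_cases hi : i ∈ Set.range δ
    · obtain ⟨j, rfl⟩ := hi
      simp [hδ.injective.eq_iff]
    · rw [Finset.sum_eq_zero]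
      · by_contra h
        exact hi ((hmem i).1 (Ne.symm h))
      · intro j _
        exact if_neg fun h => hi ⟨j, h⟩
  have htot : ∑ j, t (δ j) = 1 := by
    have h1 := t.2.2
    change ∑ i, t i = 1 at h1
    rw [← h1, ← Finset.sum_congr rfl fun i _ => hsum i, Finset.sum_comm]
    simp
  refine ⟨m, δ, ⟨fun j => t (δ j), fun j => t.2.1 _, htot⟩, ?_, fun i => (hmem _).2 ⟨i, rfl⟩⟩
  ext i
  rw [stdSimplex.map_coe, FunOnFinite.linearMap_apply_apply]
  rw [← hsum i, Finset.sum_filter]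
  rfl

theorem nerveCell_eq {n m : ℕ} {σ : Fin (n + 1) →o P} (hσ : StrictMono σ)
    {s : stdSimplex ℝ (Fin (n + 1))} (τ : Fin (m + 1) →o P) (t : stdSimplex ℝ (Fin (m + 1)))
    (h : OrderRealization.push τ τ.isChain_fin t = OrderRealization.push σ σ.isChain_fin s)
    (hr : ∀ p, (OrderRealization.push σ σ.isChain_fin s).1 p ≠ 0 → p ∈ Set.range σ) :
    nerveCell τ t = nerveCell σ s := by
  classical
  obtain ⟨k, δ, t', rfl, hδ⟩ := exists_map_eq t
  obtain ⟨θ, hθ⟩ := exists_comp_eq_of_range_subset hσ (τ.comp δ) (by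
    rintro _ ⟨i, rfl⟩
    refine hr _ ?_
    rw [← h, OrderRealization.push_apply]
    refine ne_of_gt (Finset.sum_pos' (fun j _ => ?_) ⟨δ i, Finset.mem_univ _, ?_⟩)
    · split_ifs
      · exact (stdSimplex.map δ t').2.1 j
      · exact le_rfl
    · rw [if_pos (by rfl)]
      exact lt_of_le_of_ne ((stdSimplex.map δ t').2.1 _) (hδ i).symm)
  rw [← nerveCell_comp, ← hθ, nerveCell_comp]
  congr 1
  ext i
  have h1 : OrderRealization.push σ σ.isChain_fin (stdSimplex.map θ t') =
      OrderRealization.push σ σ.isChain_fin s := by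
    rw [← h, OrderRealization.push_map, OrderRealization.push_map]
    have : (σ ∘ θ : Fin (k + 1) → P) = τ ∘ δ := congrArg (fun f : Fin (k + 1) →o P => ⇑f) hθ
    congr 1
  exact (OrderRealization.push_apply_of_injective σ σ.isChain_fin hσ.injective _ i).symm.trans
    ((congrArg (fun x : OrderRealization P => x.1 (σ i)) h1).trans
      (OrderRealization.push_apply_of_injective σ σ.isChain_fin hσ.injective _ i))

theorem exists_push_eq (x : OrderRealization P) :
    ∃ (n : ℕ) (σ : Fin (n + 1) →o P) (s : stdSimplex ℝ (Fin (n + 1))), StrictMono σ ∧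
      OrderRealization.push σ σ.isChain_fin s = x ∧ ∀ p, x.1 p ≠ 0 → p ∈ Set.range σ := by
  classical
  have hC : ∀ i j : x.1.support, i.1 ≤ j.1 ∨ j.1 ≤ i.1 := fun i j =>
    x.2.2.1 i.1 j.1 (Finsupp.mem_support_iff.1 i.2) (Finsupp.mem_support_iff.1 j.2)
  obtain ⟨p, hp⟩ := x.exists_ne_zero
  obtain ⟨n, σ, hσ, hr⟩ := exists_orderHom_range_eq hC ⟨p, Finsupp.mem_support_iff.2 hp⟩
  have hrange : ∀ p, x.1 p ≠ 0 → p ∈ Set.range σ := fun p hp => by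
    rw [hr]
    exact Finsupp.mem_support_iff.2 hp
  obtain ⟨t, ht, -⟩ := OrderRealization.push_val_of_support_subset x.1.support hC x subset_rfl
  choose ρ hρ using fun i : x.1.support => hrange i.1 (Finsupp.mem_support_iff.1 i.2)
  refine ⟨n, σ, stdSimplex.map ρ t, hσ, ?_, hrange⟩
  rw [OrderRealization.push_map]
  refine Eq.trans ?_ ht
  congr 1
  exact funext hρ

/-- The comparison map to the simplicial realization of the nerve. -/
noncomputable def orderRealizationToNerve (x : OrderRealization P) : SSet.toTop.obj (nerve P) :=
  nerveCell (exists_push_eq x).choose_spec.choose (exists_push_eq x).choose_spec.choose_spec.choose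

theorem orderRealizationToNerve_push {n : ℕ} (τ : Fin (n + 1) →o P)
    (t : stdSimplex ℝ (Fin (n + 1))) :
    orderRealizationToNerve (OrderRealization.push τ τ.isChain_fin t) = nerveCell τ t := by
  obtain ⟨hσ, hs, hr⟩ := (exists_push_eq
    (OrderRealization.push τ τ.isChain_fin t)).choose_spec.choose_spec.choose_spec
  refine (nerveCell_eq hσ τ t hs.symm fun p hp => hr p ?_).symm
  rwa [hs] at hp

theorem continuous_orderRealizationToNerve :
    Continuous (orderRealizationToNerve (P := P)) := by
  refine OrderRealization.continuous_iff.2 fun C => ?_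
  rcases C.1.eq_empty_or_nonempty with hC | hC
  · refine continuous_iff_continuousAt.2 fun t => absurd t.2.2 ?_
    have : IsEmpty C.1 := ⟨fun i => by simpa [hC] using i.2⟩
    simp
  · obtain ⟨n, σ, hσ, hr⟩ := exists_orderHom_range_eq C.2 hC
    choose ρ hρ using fun i : C.1 => (hr ▸ i.2 : i.1 ∈ Set.range σ)
    have : orderRealizationToNerve ∘ OrderRealization.push (Subtype.val : C.1 → P) C.2 =
        nerveCell σ ∘ stdSimplex.map ρ := by
      ext1 t
      rw [Function.comp_apply, Function.comp_apply, ← orderRealizationToNerve_push,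
        OrderRealization.push_map]
      congr 2
      exact (funext hρ).symm
    rw [this]
    exact (nerveCell σ).continuous.comp (stdSimplex.continuous_map ρ)

theorem orderRealizationToNerve_nerveToOrderRealization (x : SSet.toTop.obj (nerve P)) :
    orderRealizationToNerve (nerveToOrderRealization x) = x := by
  let Ψ : TopCat.of (OrderRealization P) ⟶ SSet.toTop.obj (nerve P) :=
    TopCat.ofHom ⟨orderRealizationToNerve, continuous_orderRealizationToNerve⟩
  suffices h : nerveToOrderRealization ≫ Ψ = 𝟙 _ from ConcreteCategory.congr_hom h x
  apply (sSetTopAdj.homEquiv _ _).injective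
  rw [Adjunction.homEquiv_unit, Adjunction.homEquiv_unit]
  ext n σ
  apply (TopCat.toSSetObjEquiv _ n).injective
  ext1 t
  let σ' : ComposableArrows P n.unop.len := σ
  let τ : Fin (n.unop.len + 1) →o P := ⟨σ'.obj, σ'.monotone⟩
  have h1 : orderRealizationToNerve (nerveToOrderRealization (nerveCell τ t)) =
      nerveCell τ t := by
    rw [nerveToOrderRealization_nerveCell]
    exact orderRealizationToNerve_push τ t
  exact h1

theorem PosetFills.fillsSphere_nerve {D : ℤ} (h : PosetFills P D) {n : ℕ} (hn : (n : ℤ) ≤ D + 1) :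
    FillsSphere n (Set.univ : Set (SSet.toTop.obj (nerve P))) := by
  intro f hf _
  obtain ⟨g, hg, -, hgf⟩ := h.2 n hn (fun y => nerveToOrderRealization (f y))
    (nerveToOrderRealization.hom.continuous.comp_continuousOn hf) (Set.mapsTo_univ _ _)
  refine ⟨fun y => orderRealizationToNerve (g y),
    continuous_orderRealizationToNerve.comp_continuousOn hg, Set.mapsTo_univ _ _, fun y hy => ?_⟩
  change orderRealizationToNerve (g y) = f y
  rw [hgf hy, orderRealizationToNerve_nerveToOrderRealization]

end Nerve

section HomotopyGroups

open unitInterval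

variable {X : Type*} [TopologicalSpace X]

theorem mem_sphere_pi_iff {n : ℕ} {y : Fin n → ℝ} :
    y ∈ Metric.sphere (0 : Fin n → ℝ) 1 ↔ (∀ i, |y i| ≤ 1) ∧ ∃ i, |y i| = 1 := by
  rw [mem_sphere_zero_iff_norm]
  constructor
  · intro h
    have hle : ∀ i, |y i| ≤ 1 := fun i => h ▸ norm_le_pi_norm y i
    refine ⟨hle, ?_⟩
    by_contra! hne
    have := (pi_norm_lt_iff (x := y) one_pos).2 fun i => lt_of_le_of_ne (hle i) (hne i)
    exact this.ne h
  · rintro ⟨hle, i, hi⟩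
    exact le_antisymm ((pi_norm_le_iff_of_nonneg zero_le_one).2 hle) (hi ▸ norm_le_pi_norm y i)

theorem FillsSphere.subsingleton_homotopyGroup {n : ℕ}
    (h : FillsSphere (n + 1) (Set.univ : Set X)) (x : X) :
    Subsingleton (HomotopyGroup (Fin n) X x) := by
  refine ⟨fun a b => ?_⟩
  induction a using Quotient.inductionOn with | _ f₀ =>
  induction b using Quotient.inductionOn with | _ f₁ =>
  refine Quotient.sound ?_
  let z : (Fin (n + 1) → ℝ) → (Fin n → I) := fun y i =>
    Set.projIcc 0 1 zero_le_one ((y i.succ + 1) / 2)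
  have hz : Continuous z := by
    refine continuous_pi fun i => continuous_projIcc.comp ?_
    fun_prop
  let F : (Fin (n + 1) → ℝ) → X := fun y => if y 0 ≤ 0 then f₀ (z y) else f₁ (z y)
  have hside : ∀ y ∈ Metric.sphere (0 : Fin (n + 1) → ℝ) 1, |y 0| ≠ 1 →
      z y ∈ Cube.boundary (Fin n) := by
    intro y hy h0
    obtain ⟨i, hi⟩ := (mem_sphere_pi_iff.1 hy).2
    obtain ⟨j, rfl⟩ := Fin.exists_succ_eq.2 (fun hc => h0 (hc ▸ hi) : i ≠ 0)
    refine ⟨j, ?_⟩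
    rcases eq_or_eq_neg_of_abs_eq hi with h1 | h1
    · right
      simp [z, h1]
    · left
      simp [z, h1]
  have hF : ContinuousOn F (Metric.sphere 0 1) := by
    have hcl : IsClosed {y : Fin (n + 1) → ℝ | y 0 ≤ 0} :=
      isClosed_le (continuous_apply 0) continuous_const
    have hcl' : IsClosed {y : Fin (n + 1) → ℝ | 0 ≤ y 0} :=
      isClosed_le continuous_const (continuous_apply 0)
    have hcov : Metric.sphere (0 : Fin (n + 1) → ℝ) 1 ⊆
        (Metric.sphere 0 1 ∩ {y | y 0 ≤ 0}) ∪ (Metric.sphere 0 1 ∩ {y | 0 ≤ y 0}) := by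
      intro y hy
      exact (le_total (y 0) 0).imp (fun h => ⟨hy, h⟩) (fun h => ⟨hy, h⟩)
    refine ContinuousOn.mono (ContinuousOn.union_of_isClosed ?_ ?_
      (Metric.isClosed_sphere.inter hcl) (Metric.isClosed_sphere.inter hcl')) hcov
    · refine ((f₀.1.continuous.comp hz).continuousOn).congr fun y hy => ?_
      exact if_pos hy.2
    · refine ((f₁.1.continuous.comp hz).continuousOn).congr fun y hy => ?_
      have h0' : 0 ≤ y 0 := hy.2
      rcases h0'.eq_or_lt with h0 | h0
      · have hb := hside y hy.1 (by rw [← h0]; simp)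
        exact (if_pos h0.ge).trans ((f₀.2 _ hb).trans (f₁.2 _ hb).symm)
      · exact if_neg (not_le.2 h0)
  obtain ⟨g, hg, -, hgF⟩ := h F hF (Set.mapsTo_univ _ _)
  let e : I × (Fin n → I) → (Fin (n + 1) → ℝ) := fun p =>
    Fin.cons (2 * (p.1 : ℝ) - 1) fun i => 2 * (p.2 i : ℝ) - 1
  have he : Continuous e := by
    refine continuous_pi fun i => ?_
    refine Fin.cases ?_ (fun i => ?_) i
    · simp only [e, Fin.cons_zero]
      fun_prop
    · simp only [e, Fin.cons_succ]
      fun_prop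
  have habs : ∀ t : I, |2 * (t : ℝ) - 1| ≤ 1 := fun t =>
    abs_le.2 ⟨by linarith [t.2.1], by linarith [t.2.2]⟩
  have hle : ∀ p i, |e p i| ≤ 1 := fun p i => by
    refine Fin.cases ?_ (fun i => ?_) i
    · exact habs p.1
    · exact habs (p.2 i)
  have hball : ∀ p, e p ∈ Metric.closedBall (0 : Fin (n + 1) → ℝ) 1 := fun p =>
    mem_closedBall_zero_iff.2 ((pi_norm_le_iff_of_nonneg zero_le_one).2 (hle p))
  have hze : ∀ p, z (e p) = p.2 := fun p => by
    ext1 i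
    have : (e p i.succ + 1) / 2 = (p.2 i : ℝ) := by
      simp only [e, Fin.cons_succ]
      ring
    simp only [z, this, Set.projIcc_val]
  refine ⟨⟨⟨⟨fun p => g (e p), hg.comp_continuous he hball⟩, fun p => ?_, fun p => ?_⟩, ?_⟩⟩
  · change g (e (0, p)) = f₀ p
    rw [hgF (mem_sphere_pi_iff.2 ⟨hle _, 0, by simp [e]⟩)]
    simp only [F, hze]
    exact if_pos (by simp [e])
  · change g (e (1, p)) = f₁ p
    rw [hgF (mem_sphere_pi_iff.2 ⟨hle _, 0, by norm_num [e]⟩)]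
    simp only [F, hze]
    exact if_neg (by norm_num [e])
  · intro t p hp
    change g (e (t, p)) = f₀ p
    have hs : e (t, p) ∈ Metric.sphere (0 : Fin (n + 1) → ℝ) 1 := by
      obtain ⟨i, hi⟩ := hp
      refine mem_sphere_pi_iff.2 ⟨hle _, i.succ, ?_⟩
      simp only [e, Fin.cons_succ]
      rcases hi with hi | hi
      · simp [hi]
      · simp only [hi]
        norm_num
    rw [hgF hs]
    simp only [F, hze]
    rw [GenLoop.boundary f₀ p hp, GenLoop.boundary f₁ p hp, ite_self]

theorem PosetFills.posetDConnected {P : Type} [PartialOrder P] {d : ℤ} (h : PosetFills P d) :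
    PosetDConnected P d := by
  rcases le_or_gt d (-2) with hd | hd
  · exact Or.inl hd
  · refine Or.inr ⟨?_, fun n hn x =>
      FillsSphere.subsingleton_homotopyGroup (h.fillsSphere_nerve (by push_cast; omega)) x⟩
    obtain ⟨p⟩ := h.1 (by omega)
    exact ⟨nerveCell (n := 0) (OrderHom.const _ p) (stdSimplex.vertex 0)⟩

end HomotopyGroups

section RightModules

variable (R : Type*) [Ring R] {W W' A N C : Type*}
  [AddCommGroup W] [Module Rᵐᵒᵖ W] [AddCommGroup W'] [Module Rᵐᵒᵖ W']
  [AddCommGroup A] [Module Rᵐᵒᵖ A] [AddCommGroup N] [Module Rᵐᵒᵖ N]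
  [AddCommGroup C] [Module Rᵐᵒᵖ C]

/-- The homomorphism from the right module `R` sending `1` to `m`. -/
def rightSpan (m : W) : R →ₗ[Rᵐᵒᵖ] W where
  toFun r := op r • m
  map_add' r r' := by rw [MulOpposite.op_add, add_smul]
  map_smul' a r := by
    rw [MulOpposite.smul_eq_mul_unop, MulOpposite.op_mul, MulOpposite.op_unop, mul_smul,
      RingHom.id_apply]

theorem rightSpan_apply (m : W) (r : R) : rightSpan R m r = op r • m := rfl

variable {R}

theorem map_op_smul (φ : W →ₗ[Rᵐᵒᵖ] R) (r : R) (x : W) : φ (op r • x) = φ x * r := by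
  rw [map_smul, op_smul_eq_mul]

variable (R)

/-- The unimodularity of a list of vectors, in terms of functionals. -/
def IsUnimodularList (l : List W) : Prop :=
  l.Nodup ∧ ∀ x ∈ l, ∃ φ : W →ₗ[Rᵐᵒᵖ] R, φ x = 1 ∧ ∀ y ∈ l, y ≠ x → φ y = 0

/-- The words over `Y` whose concatenation with `v` is unimodular. -/
def unimodularWords (Y : Set W) (v : List W) : Set (OSeq W) :=
  {w | (∀ x ∈ w.1, x ∈ Y) ∧ IsUnimodularList R (w.1 ++ v)}

variable {R}

theorem IsUnimodularList.sublist {l l' : List W} (h : IsUnimodularList R l) (hl : l'.Sublist l) :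
    IsUnimodularList R l' :=
  ⟨h.1.sublist hl, fun x hx =>
    let ⟨φ, h1, h2⟩ := h.2 x (hl.subset hx)
    ⟨φ, h1, fun y hy => h2 y (hl.subset hy)⟩⟩

theorem IsUnimodularList.perm {l l' : List W} (h : IsUnimodularList R l) (hl : l.Perm l') :
    IsUnimodularList R l' :=
  ⟨hl.nodup_iff.1 h.1, fun x hx =>
    let ⟨φ, h1, h2⟩ := h.2 x (hl.mem_iff.2 hx)
    ⟨φ, h1, fun y hy => h2 y (hl.mem_iff.2 hy)⟩⟩

theorem isUnimodularList_nil : IsUnimodularList R ([] : List W) := by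
  simp [IsUnimodularList]

theorem isUnimodularList_singleton {x : W} (φ : W →ₗ[Rᵐᵒᵖ] R) (h : φ x = 1) :
    IsUnimodularList R [x] := by
  refine ⟨List.nodup_singleton x, fun y hy => ⟨φ, ?_, fun z hz hzy => ?_⟩⟩
  · rw [List.mem_singleton.1 hy, h]
  · exact absurd ((List.mem_singleton.1 hz).trans (List.mem_singleton.1 hy).symm) hzy

theorem isUnimodularList_map_iff {j : W' →ₗ[Rᵐᵒᵖ] W} {p : W →ₗ[Rᵐᵒᵖ] W'}
    (hpj : ∀ x, p (j x) = x) {l : List W'} :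
    IsUnimodularList R (l.map j) ↔ IsUnimodularList R l := by
  have hj : Function.Injective j := Function.LeftInverse.injective hpj
  constructor
  · rintro ⟨h1, h2⟩
    refine ⟨List.Nodup.of_map _ h1, fun x hx => ?_⟩
    obtain ⟨φ, h3, h4⟩ := h2 (j x) (List.mem_map_of_mem hx)
    exact ⟨φ.comp j, h3, fun y hy hne => h4 (j y) (List.mem_map_of_mem hy) (hj.ne hne)⟩
  · rintro ⟨h1, h2⟩
    refine ⟨h1.map hj, fun x' hx' => ?_⟩
    obtain ⟨x, hx, rfl⟩ := List.mem_map.1 hx'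
    obtain ⟨φ, h3, h4⟩ := h2 x hx
    refine ⟨φ.comp p, by simp [hpj, h3], fun y' hy' hne => ?_⟩
    obtain ⟨y, hy, rfl⟩ := List.mem_map.1 hy'
    simp [hpj, h4 y hy (fun h => hne (h ▸ rfl))]

theorem isUnimodularSeq_get_iff {l : List W} (hl : l.Nodup) :
    IsUnimodularSeq R W (fun i : Fin l.length => l.get i) ↔ IsUnimodularList R l := by
  constructor
  · rintro ⟨f, φ, hf, hφ⟩
    have key : ∀ i j, φ j (l.get i) = if i = j then 1 else 0 := fun i j => by
      have hfi : f i 1 = l.get i := hf i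
      rw [← hfi]
      have := congrArg (fun g : R →ₗ[Rᵐᵒᵖ] R => g 1) (hφ i j)
      simp only [LinearMap.comp_apply] at this
      rw [this]
      split_ifs <;> rfl
    refine ⟨hl, fun x hx => ?_⟩
    obtain ⟨i, rfl⟩ := List.mem_iff_get.1 hx
    refine ⟨φ i, by rw [key, if_pos rfl], fun y hy hne => ?_⟩
    obtain ⟨j, rfl⟩ := List.mem_iff_get.1 hy
    rw [key, if_neg]
    rintro rfl
    exact hne rfl
  · rintro ⟨-, h⟩
    choose φ h1 h2 using fun i : Fin l.length => h (l.get i) (List.get_mem l i)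
    refine ⟨fun i => rightSpan R (l.get i), φ, fun i => ?_, fun i j => ?_⟩
    · rw [rightSpan_apply, MulOpposite.op_one, one_smul]
    · refine LinearMap.ext fun r => ?_
      rw [LinearMap.comp_apply, rightSpan_apply, map_op_smul]
      by_cases hij : i = j
      · subst hij
        rw [h1, if_pos rfl, one_mul, LinearMap.id_apply]
      · rw [h2 j _ (List.get_mem l i) (fun h => hij (List.nodup_iff_injective_get.1 hl h)),
          if_neg hij, zero_mul, LinearMap.zero_apply]

/-- Unimodularity of a list is checked after splitting off one of its members. -/
theorem isUnimodularList_cons_iff [Nontrivial R] {p : W →ₗ[Rᵐᵒᵖ] W'} {j : W' →ₗ[Rᵐᵒᵖ] W}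
    {α : W →ₗ[Rᵐᵒᵖ] R} {v : W} (hαv : α v = 1) (hpv : p v = 0)
    (hdec : ∀ x, x = j (p x) + op (α x) • v) {l : List W} :
    IsUnimodularList R (v :: l) ↔ IsUnimodularList R (l.map p) := by
  classical
  constructor
  · rintro ⟨h1, h2⟩
    obtain ⟨hv, hl⟩ := List.nodup_cons.1 h1
    have hval : ∀ (φ : W →ₗ[Rᵐᵒᵖ] R), φ v = 0 → ∀ x, φ (j (p x)) = φ x := fun φ hφ x => by
      conv_rhs => rw [hdec x]
      rw [map_add, map_op_smul, hφ, zero_mul, add_zero]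
    have key : ∀ x ∈ l, ∃ φ : W' →ₗ[Rᵐᵒᵖ] R, φ (p x) = 1 ∧ ∀ y ∈ l, y ≠ x → φ (p y) = 0 := by
      intro x hx
      obtain ⟨φ, h3, h4⟩ := h2 x (List.mem_cons_of_mem _ hx)
      have hφv : φ v = 0 := h4 v List.mem_cons_self (fun h => hv (h ▸ hx))
      refine ⟨φ.comp j, (hval φ hφv x).trans h3, fun y hy hne => (hval φ hφv y).trans ?_⟩
      exact h4 y (List.mem_cons_of_mem _ hy) hne
    refine ⟨hl.map_on fun x hx y hy hxy => ?_, fun x' hx' => ?_⟩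
    · by_contra hne
      obtain ⟨φ, h3, h4⟩ := key x hx
      have := h4 y hy (Ne.symm hne)
      rw [← hxy, h3] at this
      exact one_ne_zero this
    · obtain ⟨x, hx, rfl⟩ := List.mem_map.1 hx'
      obtain ⟨φ, h3, h4⟩ := key x hx
      refine ⟨φ, h3, fun y' hy' hne => ?_⟩
      obtain ⟨y, hy, rfl⟩ := List.mem_map.1 hy'
      exact h4 y hy fun h => hne (h ▸ rfl)
  · rintro ⟨h1, h2⟩
    have hl : l.Nodup := List.Nodup.of_map _ h1
    have hinj : ∀ x ∈ l, ∀ y ∈ l, p x = p y → x = y := fun x hx y hy h =>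
      List.inj_on_of_nodup_map h1 hx hy h
    choose! ψ h3 h4 using h2
    have hv : v ∉ l := fun hv => by
      have := h3 _ (List.mem_map_of_mem hv)
      rw [hpv, map_zero] at this
      exact zero_ne_one this
    refine ⟨List.nodup_cons.2 ⟨hv, hl⟩, fun x hx => ?_⟩
    rcases List.mem_cons.1 hx with rfl | hx
    · refine ⟨α - ∑ y ∈ l.toFinset, (rightSpan R (α y)).comp ((ψ (p y)).comp p), ?_, ?_⟩
      · simp [hαv, hpv]
      · intro y hy hne
        have hy : y ∈ l := (List.mem_cons.1 hy).resolve_left hne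
        rw [LinearMap.sub_apply, LinearMap.sum_apply, Finset.sum_eq_single y]
        · simp [h3 _ (List.mem_map_of_mem hy), rightSpan_apply]
        · intro z hz hzy
          have hz : z ∈ l := List.mem_toFinset.1 hz
          simp [h4 (p z) (List.mem_map_of_mem hz) (p y) (List.mem_map_of_mem hy)
            (fun h => hzy (hinj y hy z hz h).symm), rightSpan_apply]
        · intro h
          exact absurd (List.mem_toFinset.2 hy) h
    · refine ⟨(ψ (p x)).comp p, h3 _ (List.mem_map_of_mem hx), fun y hy hne => ?_⟩
      rcases List.mem_cons.1 hy with rfl | hy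
      · simp [hpv]
      · exact h4 _ (List.mem_map_of_mem hx) _ (List.mem_map_of_mem hy)
          fun h => hne (hinj y hy x hx h)

theorem isUnimodularList_append_cons_iff [Nontrivial R] {p : W →ₗ[Rᵐᵒᵖ] W'}
    {j : W' →ₗ[Rᵐᵒᵖ] W} {α : W →ₗ[Rᵐᵒᵖ] R} {v : W} (hαv : α v = 1) (hpv : p v = 0)
    (hdec : ∀ x, x = j (p x) + op (α x) • v) {l t : List W} :
    IsUnimodularList R (l ++ v :: t) ↔ IsUnimodularList R ((l ++ t).map p) := by
  rw [← isUnimodularList_cons_iff hαv hpv hdec]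
  exact ⟨fun h => h.perm List.perm_middle, fun h => h.perm List.perm_middle.symm⟩

end RightModules

theorem List.sublist_map_iff_of_injective {α β : Type*} {j : α → β} (hj : Function.Injective j)
    {a b : List α} : (a.map j).Sublist (b.map j) ↔ a.Sublist b := by
  refine ⟨fun h => ?_, fun h => h.map j⟩
  obtain ⟨l, hl, h⟩ := List.sublist_map_iff.1 h
  rwa [List.map_injective_iff.2 hj h]

theorem List.exists_map_eq_of_forall_mem_image {α β : Type*} {j : α → β} {X : Set α} {w : List β}
    (h : ∀ x ∈ w, x ∈ j '' X) : ∃ l : List α, l.map j = w ∧ ∀ x ∈ l, x ∈ X := by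
  induction w with
  | nil => exact ⟨[], rfl, by simp⟩
  | cons x w ih =>
    obtain ⟨l, rfl, hl⟩ := ih fun y hy => h y (List.mem_cons_of_mem _ hy)
    obtain ⟨y, hy, rfl⟩ := h x List.mem_cons_self
    exact ⟨y :: l, rfl, by simpa [hy] using hl⟩

section UnimodularWords

variable {R W W' : Type} [Ring R] [AddCommGroup W] [Module Rᵐᵒᵖ W] [AddCommGroup W']
  [Module Rᵐᵒᵖ W'] {D : ℤ}

theorem PosetFills.unimodularWords_image {j : W' →ₗ[Rᵐᵒᵖ] W} (hj : Function.Injective j)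
    {X : Set W'} {v : List W} {v' : List W'}
    (hv : ∀ w : List W', (∀ x ∈ w, x ∈ X) →
      (IsUnimodularList R (w.map j ++ v) ↔ IsUnimodularList R (w ++ v')))
    (h : PosetFills (unimodularWords R X v') D) :
    PosetFills (unimodularWords R (j '' X) v) D := by
  refine h.of_surjective (fun w => ⟨OSeq.of (w.1.1.map j)
    ⟨by simpa using w.1.2.1, w.1.2.2.map hj⟩, ?_, (hv _ w.2.1).2 w.2.2⟩)
    (fun a b => List.sublist_map_iff_of_injective hj) ?_
  · intro x hx
    obtain ⟨y, hy, rfl⟩ := List.mem_map.1 hx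
    exact ⟨y, w.2.1 y hy, rfl⟩
  · rintro ⟨w, hwX, hw⟩
    obtain ⟨l, hl, hlX⟩ := List.exists_map_eq_of_forall_mem_image hwX
    refine ⟨⟨OSeq.of l ⟨?_, ?_⟩, hlX, (hv l hlX).1 (hl ▸ hw)⟩, Subtype.ext (Subtype.ext hl)⟩
    · rintro rfl
      exact w.2.1 hl.symm
    · exact List.Nodup.of_map j (hl ▸ w.2.2)

theorem chainCondition_unimodularWords (Y : Set W) (v : List W) :
    ChainCondition (unimodularWords R Y v) := fun _ _ hab hb =>
  ⟨fun x hx => hb.1 x (List.Sublist.subset hab hx),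
    hb.2.sublist (List.Sublist.append_right hab v)⟩

theorem prefixWords_unimodularWords {X Y : Set W} (hXY : X ⊆ Y) {v : List W} {u : OSeq W}
    (hu : ∀ x ∈ u.1, x ∈ Y) :
    prefixWords (unimodularWords R Y v) X u.1 = unimodularWords R X (u.1 ++ v) := by
  ext w
  constructor
  · rintro ⟨hw, h, -, h2⟩
    exact ⟨hw, by simpa [OSeq.of] using h2⟩
  · rintro ⟨hw, h⟩
    have h' : IsUnimodularList R ((w.1 ++ u.1) ++ v) := by simpa using h
    refine ⟨hw, ⟨by simp [w.2.1], (h'.sublist (List.sublist_append_left _ _)).1⟩, ?_, h'⟩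
    intro x hx
    rcases List.mem_append.1 hx with hx | hx
    · exact hXY (hw x hx)
    · exact hu x hx

theorem unimodularWords_inter_seqIn {X Y : Set W} (hXY : X ⊆ Y) (v : List W) :
    unimodularWords R Y v ∩ SeqIn X = unimodularWords R X v :=
  Set.ext fun _ => ⟨fun h => ⟨h.2, h.1.2⟩, fun h => ⟨⟨fun x hx => hXY (h.1 x hx), h.2⟩, h.1⟩⟩

theorem PosetFills.unimodularWords_of_subset {X Y : Set W} (hXY : X ⊆ Y) {v : List W}
    (hv : IsUnimodularList R v)
    (h : ∀ u : List W, IsUnimodularList R (u ++ v) →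
      PosetFills (unimodularWords R X (u ++ v)) (D - u.length)) :
    PosetFills (unimodularWords R Y v) D := by
  refine PosetFills.of_seqIn (X := X) (chainCondition_unimodularWords Y v) ?_ ?_
  · rw [unimodularWords_inter_seqIn hXY]
    simpa using h [] hv
  · intro u hu _
    rw [prefixWords_unimodularWords hXY hu.1]
    exact h u.1 hu.2

end UnimodularWords

section StableRange

variable (R : Type) [Ring R]

/-- The stable range condition for a module `A` in place of a finite power of `R`. -/
def StableRangeFor (A : Type) [AddCommGroup A] [Module Rᵐᵒᵖ A] : Prop :=
  ∀ (r : A) (z : R) (γ : A →ₗ[Rᵐᵒᵖ] R) (c : R), γ r + c * z = 1 →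
    ∃ (t : A) (γ' : A →ₗ[Rᵐᵒᵖ] R), γ' (r + op z • t) = 1

/-- `A` is isomorphic to a direct summand of `N`. -/
def IsSummand (A N : Type) [AddCommGroup A] [Module Rᵐᵒᵖ A] [AddCommGroup N]
    [Module Rᵐᵒᵖ N] : Prop :=
  ∃ (ι : A →ₗ[Rᵐᵒᵖ] N) (π : N →ₗ[Rᵐᵒᵖ] A), ∀ x, π (ι x) = x

variable {R} {A A' N C : Type}
  [AddCommGroup A] [Module Rᵐᵒᵖ A] [AddCommGroup A'] [Module Rᵐᵒᵖ A']
  [AddCommGroup N] [Module Rᵐᵒᵖ N] [AddCommGroup C] [Module Rᵐᵒᵖ C]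

theorem IsSummand.of_equiv_left (h : IsSummand R A N) (e : A ≃ₗ[Rᵐᵒᵖ] A') : IsSummand R A' N :=
  let ⟨ι, π, h⟩ := h
  ⟨ι.comp e.symm.toLinearMap, e.toLinearMap.comp π, fun x => by simp [h]⟩

theorem isUnimodularSeq_one_iff {r : A} :
    IsUnimodularSeq R A (fun _ : Fin 1 => r) ↔ ∃ φ : A →ₗ[Rᵐᵒᵖ] R, φ r = 1 := by
  rw [← show (fun i : Fin [r].length => [r].get i) = fun _ : Fin 1 => r by
    funext i; simp, isUnimodularSeq_get_iff (List.nodup_singleton r)]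
  refine ⟨fun h => ?_, fun ⟨φ, h⟩ => isUnimodularList_singleton φ h⟩
  obtain ⟨φ, h, -⟩ := h.2 r List.mem_cons_self
  exact ⟨φ, h⟩

theorem StableRangeFor.of_equiv (h : StableRangeFor R A) (e : A ≃ₗ[Rᵐᵒᵖ] A') :
    StableRangeFor R A' := by
  intro r z γ c hr
  obtain ⟨t, γ', h'⟩ := h (e.symm r) z (γ.comp e.toLinearMap) c (by simpa using hr)
  exact ⟨e t, γ'.comp e.symm.toLinearMap, by simpa using h'⟩

theorem StableRangeFor.prod (h : StableRangeFor R A) : StableRangeFor R (A × R) := by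
  rintro ⟨r, a⟩ z γ c hr
  have hb : ∀ y : R, γ (0, y) = γ (0, 1) * y := fun y => by
    rw [← map_op_smul]; simp
  have hsplit : ∀ x y, γ (x, y) = γ (x, 0) + γ (0, 1) * y := fun x y => by
    rw [← hb, ← map_add]; simp
  obtain ⟨t, γ', h'⟩ := h r (γ (0, 1) * a + c * z) (γ.comp (LinearMap.inl _ _ _)) 1 (by
    rw [one_mul, LinearMap.comp_apply, LinearMap.inl_apply, ← add_assoc, ← hsplit]
    exact hr)
  refine ⟨(op c • t, 0), γ'.comp ((LinearMap.fst _ _ _) +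
    (rightSpan R t).comp ((rightSpan R (γ (0, 1))).comp (LinearMap.snd _ _ _))), ?_⟩
  refine Eq.trans ?_ h'
  simp only [LinearMap.comp_apply, LinearMap.add_apply, LinearMap.fst_apply, LinearMap.snd_apply,
    rightSpan_apply, Prod.mk_add_mk, Prod.smul_mk, smul_zero, add_zero, op_smul_eq_mul]
  congr 1
  rw [MulOpposite.op_add, add_smul, smul_smul, ← MulOpposite.op_mul]
  abel

/-- The splitting of the last coordinate. -/
def snocEquiv (n : ℕ) : (Fin (n + 1) → R) ≃ₗ[Rᵐᵒᵖ] (Fin n → R) × R where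
  toFun x := (fun i => x i.castSucc, x (Fin.last n))
  invFun y := Fin.snoc y.1 y.2
  map_add' _ _ := rfl
  map_smul' _ _ := rfl
  left_inv x := Fin.snoc_init_self x
  right_inv y := by simp

theorem SatisfiesStableRange.stableRangeFor {s : ℕ} (hs : SatisfiesStableRange R s) :
    StableRangeFor R (Fin s → R) := by
  intro r z γ c hr
  obtain ⟨t, ht⟩ := hs ((snocEquiv s).symm (r, z)) (isUnimodularSeq_one_iff.2
    ⟨(γ.comp (LinearMap.fst _ _ _) + (rightSpan R c).comp (LinearMap.snd _ _ _)).comp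
      (snocEquiv s).toLinearMap, by simpa [rightSpan_apply] using hr⟩)
  obtain ⟨γ', h'⟩ := isUnimodularSeq_one_iff.1 ht
  refine ⟨t, γ', ?_⟩
  refine Eq.trans ?_ h'
  congr 1
  funext i
  change r i + t i * z = Fin.snoc (α := fun _ => R) r z i.castSucc +
    t i * Fin.snoc (α := fun _ => R) r z (Fin.last s)
  simp

theorem SatisfiesStableRange.stableRangeFor_of_le {s n : ℕ} (hs : SatisfiesStableRange R s)
    (h : s ≤ n) : StableRangeFor R (Fin n → R) := by
  induction n, h using Nat.le_induction with
  | base => exact hs.stableRangeFor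
  | succ n _ ih => exact ih.prod.of_equiv (snocEquiv n).symm

theorem SatisfiesStableRange.ne_zero [Nontrivial R] {s : ℕ} (hs : SatisfiesStableRange R s) :
    s ≠ 0 := by
  rintro rfl
  obtain ⟨t, γ, h⟩ := hs.stableRangeFor 0 1 0 1 (by simp)
  rw [Subsingleton.elim (0 + op 1 • t) 0, map_zero] at h
  exact zero_ne_one h

/-- A unimodular vector of `N × C` can be moved so that its projection to a summand of `N` is
unimodular. -/
theorem StableRangeFor.exists_shear (hA : StableRangeFor R A) {ι : A →ₗ[Rᵐᵒᵖ] N}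
    {π : N →ₗ[Rᵐᵒᵖ] A} (hι : ∀ x, π (ι x) = x) {φ : N × C →ₗ[Rᵐᵒᵖ] R} {n : N} {c : C}
    (hφ : φ (n, c) = 1) :
    ∃ (h : C →ₗ[Rᵐᵒᵖ] N) (π' : N →ₗ[Rᵐᵒᵖ] A) (γ : A →ₗ[Rᵐᵒᵖ] R),
      (∀ x, π' (ι x) = x) ∧ γ (π' (n + h c)) = 1 := by
  set φN : N →ₗ[Rᵐᵒᵖ] R := φ.comp (LinearMap.inl _ _ _) with hφN
  set φC : C →ₗ[Rᵐᵒᵖ] R := φ.comp (LinearMap.inr _ _ _) with hφC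
  have hsplit : φN n + φC c = 1 := by
    rw [← hφ, hφN, hφC, LinearMap.comp_apply, LinearMap.comp_apply, ← map_add]
    simp
  obtain ⟨t, γ, hγ⟩ := hA (π n) (φN (n - ι (π n)) + φC c) (φN.comp ι) 1 (by
    rw [one_mul, LinearMap.comp_apply, ← add_assoc, ← map_add, add_sub_cancel, hsplit])
  refine ⟨ι.comp ((rightSpan R t).comp φC),
    π + (rightSpan R t).comp (φN.comp (LinearMap.id - ι.comp π)), γ, fun x => ?_, ?_⟩
  · simp [hι]
  · refine Eq.trans ?_ hγ
    congr 1
    simp [hι, rightSpan_apply, add_smul]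
    abel

/-- A vector with unimodular projection to `A' × R` has a complement with summand `A'`. -/
theorem StableRangeFor.exists_complement (hA : StableRangeFor R A') {ι : A' × R →ₗ[Rᵐᵒᵖ] N}
    {π : N →ₗ[Rᵐᵒᵖ] A' × R} (hι : ∀ x, π (ι x) = x) {γ : A' × R →ₗ[Rᵐᵒᵖ] R} {b : N}
    (hγ : γ (π b) = 1) :
    ∃ β : N →ₗ[Rᵐᵒᵖ] R, β b = 1 ∧ IsSummand R A' (LinearMap.ker β) := by
  obtain ⟨x₀, y₀, hb⟩ : ∃ x y, π b = (x, y) := ⟨_, _, rfl⟩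
  have hsplit : γ (x₀, 0) + γ (0, 1) * y₀ = 1 := by
    refine Eq.trans ?_ (hb ▸ hγ)
    rw [← map_op_smul, ← map_add]; simp
  obtain ⟨t, γ', h'⟩ := hA x₀ y₀ (γ.comp (LinearMap.inl _ _ _)) (γ (0, 1)) hsplit
  set ρ : A' × R →ₗ[Rᵐᵒᵖ] A' := LinearMap.fst _ _ _ + (rightSpan R t).comp (LinearMap.snd _ _ _)
    with hρ
  have hρx : ∀ x y, ρ (x, y) = x + op y • t := fun x y => by simp [hρ, rightSpan_apply]
  set κ : A' →ₗ[Rᵐᵒᵖ] R := (rightSpan R (1 - y₀)).comp γ' with hκ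
  have hκx : ∀ x, κ x = (1 - y₀) * γ' x := fun x => by simp [hκ, rightSpan_apply]
  set β : N →ₗ[Rᵐᵒᵖ] R := (LinearMap.snd _ _ _ + κ.comp ρ).comp π with hβ
  have hβn : ∀ n, β n = (π n).2 + κ (ρ (π n)) := fun n => by simp [hβ]
  set σ : A' →ₗ[Rᵐᵒᵖ] N := ι.comp ((LinearMap.id + (rightSpan R t).comp κ).prod (-κ)) with hσ
  have hσx : ∀ x, π (σ x) = (x + op (κ x) • t, - κ x) := fun x => by
    simp [hσ, hι, rightSpan_apply]
  have hρσ : ∀ x, ρ (π (σ x)) = x := fun x => by rw [hσx, hρx]; simp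
  refine ⟨β, ?_, σ.codRestrict _ fun x => ?_, (ρ.comp π).comp (Submodule.subtype _), fun x => ?_⟩
  · rw [hβn, hb, hρx, hκx, h']; simp
  · rw [LinearMap.mem_ker, hβn, hρσ, hσx]; simp
  · exact hρσ x

end StableRange

section Connectivity

variable {R : Type} [Ring R] {W W' N C : Type} [AddCommGroup W] [Module Rᵐᵒᵖ W]
  [AddCommGroup W'] [Module Rᵐᵒᵖ W'] [AddCommGroup N] [Module Rᵐᵒᵖ N]
  [AddCommGroup C] [Module Rᵐᵒᵖ C]

/-- The projection to the kernel of a functional `β` along `b`. -/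
def kerProj (β : N →ₗ[Rᵐᵒᵖ] R) (b : N) (hb : β b = 1) : N →ₗ[Rᵐᵒᵖ] LinearMap.ker β :=
  (LinearMap.id - (rightSpan R b).comp β).codRestrict _ fun x => by
    simp [rightSpan_apply, hb]

theorem coe_kerProj {β : N →ₗ[Rᵐᵒᵖ] R} {b : N} (hb : β b = 1) (x : N) :
    (kerProj β b hb x : N) = x - op (β x) • b := rfl

theorem PosetFills.unimodularWords_split [Nontrivial R] {p : W →ₗ[Rᵐᵒᵖ] W'}
    {j : W' →ₗ[Rᵐᵒᵖ] W} {α : W →ₗ[Rᵐᵒᵖ] R} {v : W} (hαv : α v = 1) (hpv : p v = 0)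
    (hdec : ∀ x, x = j (p x) + op (α x) • v) (hpj : ∀ x, p (j x) = x) {X : Set W'}
    {u t : List W} {D : ℤ} (h : PosetFills (unimodularWords R X ((u ++ t).map p)) D) :
    PosetFills (unimodularWords R (j '' X) (u ++ v :: t)) D := by
  refine PosetFills.unimodularWords_image (Function.LeftInverse.injective hpj) (fun w _ => ?_) h
  rw [← List.append_assoc, isUnimodularList_append_cons_iff hαv hpv hdec]
  have : (w.map j).map p = w := by
    rw [List.map_map]
    exact List.map_id'' hpj w
  simp only [List.map_append, this, List.append_assoc]

/-- Splitting off a vector of `N × C` whose second component is unimodular. -/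
theorem exists_proj_ker_snd {ε : C →ₗ[Rᵐᵒᵖ] R} {e : C} (he : ε e = 1) (n : N) :
    ∃ p : N × C →ₗ[Rᵐᵒᵖ] N × LinearMap.ker ε, p (n, e) = 0 ∧
      (∀ x, x = LinearMap.prodMap LinearMap.id (Submodule.subtype _) (p x) +
        op (ε.comp (LinearMap.snd _ _ _) x) • (n, e)) ∧
      ∀ x, p (LinearMap.prodMap LinearMap.id (Submodule.subtype _) x) = x := by
  refine ⟨(LinearMap.fst _ _ _ - (rightSpan R n).comp (ε.comp (LinearMap.snd _ _ _))).prod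
    ((kerProj ε e he).comp (LinearMap.snd _ _ _)), ?_, ?_, ?_⟩
  · ext <;> simp [rightSpan_apply, coe_kerProj, he]
  · rintro ⟨x, c⟩
    ext <;> simp [rightSpan_apply, coe_kerProj]
  · rintro ⟨x, c, hc⟩
    have hc : ε c = 0 := hc
    ext <;> simp [rightSpan_apply, coe_kerProj, hc]

/-- Splitting off a vector of `N × C` which becomes unimodular in `N` after a shear. -/
theorem exists_proj_ker_fst {β : N →ₗ[Rᵐᵒᵖ] R} {h : C →ₗ[Rᵐᵒᵖ] N} {n : N} {c : C}
    (hb : β (n + h c) = 1) :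
    ∃ (p : N × C →ₗ[Rᵐᵒᵖ] LinearMap.ker β × C) (j : LinearMap.ker β × C →ₗ[Rᵐᵒᵖ] N × C)
      (α : N × C →ₗ[Rᵐᵒᵖ] R), α (n, c) = 1 ∧ p (n, c) = 0 ∧
      (∀ x, x = j (p x) + op (α x) • (n, c)) ∧ (∀ x, p (j x) = x) ∧ ∀ x, (j x).2 = x.2 := by
  set m : N × C →ₗ[Rᵐᵒᵖ] N := LinearMap.fst _ _ _ + h.comp (LinearMap.snd _ _ _) with hm
  refine ⟨((kerProj β _ hb).comp m).prod
    (LinearMap.snd _ _ _ - (rightSpan R c).comp (β.comp m)),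
    ((Submodule.subtype _).comp (LinearMap.fst _ _ _) - h.comp (LinearMap.snd _ _ _)).prod
      (LinearMap.snd _ _ _), β.comp m, hb, ?_, ?_, ?_, fun x => rfl⟩
  · refine Prod.ext (Subtype.ext ?_) ?_
    · change (n + h c) - op (β (n + h c)) • (n + h c) = 0
      simp [hb]
    · change c - op (β (n + h c)) • c = 0
      simp [hb]
  · rintro ⟨x, y⟩
    ext
    · change x = (x + h y - op (β (x + h y)) • (n + h c)) - h (y - op (β (x + h y)) • c) +
        op (β (x + h y)) • n
      rw [map_sub, map_smul, smul_add]
      abel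
    · simp [rightSpan_apply]
  · rintro ⟨⟨x, hx⟩, y⟩
    have hx : β x = 0 := hx
    ext <;> simp [rightSpan_apply, coe_kerProj, hm, hx]

theorem IsSummand.exists_complement {A : Type} [AddCommGroup A] [Module Rᵐᵒᵖ A]
    (h : IsSummand R (A × R) N) :
    ∃ (b : N) (β : N →ₗ[Rᵐᵒᵖ] R), β b = 1 ∧ IsSummand R A (LinearMap.ker β) := by
  obtain ⟨ι, π, h⟩ := h
  refine ⟨ι (0, 1), (LinearMap.snd _ _ _).comp π, by simp [h],
    (ι.comp (LinearMap.inl _ _ _)).codRestrict _ fun x => by simp [h],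
    ((LinearMap.fst _ _ _).comp π).comp (Submodule.subtype _),
    fun x => congrArg Prod.fst (h (x, 0))⟩

variable (R) in
/-- The connectivity of the unimodular words in `N ⊆ N × C` when `R^g` is a summand of `N`. -/
def UnimodularFills (s g : ℕ) : Prop :=
  ∀ (N C : Type) [AddCommGroup N] [Module Rᵐᵒᵖ N] [AddCommGroup C] [Module Rᵐᵒᵖ C],
    IsSummand R (Fin g → R) N → ∀ v : List (N × C), IsUnimodularList R v →
      PosetFills (unimodularWords R {p : N × C | p.2 = 0} v) ((g : ℤ) - s - 1 - v.length)

variable (R) in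
/-- The connectivity of the unimodular words in `N ∪ (N + e) ⊆ N × C` when `R^g` is a summand
of `N` and `e` is unimodular in `C`. -/
def UnimodularFillsShifted (s g : ℕ) : Prop :=
  ∀ (N C : Type) [AddCommGroup N] [Module Rᵐᵒᵖ N] [AddCommGroup C] [Module Rᵐᵒᵖ C]
    (e : C) (ε : C →ₗ[Rᵐᵒᵖ] R), ε e = 1 →
    IsSummand R (Fin g → R) N → ∀ v : List (N × C), IsUnimodularList R v →
      PosetFills (unimodularWords R {p : N × C | p.2 = 0 ∨ p.2 = e} v) ((g : ℤ) - s - v.length)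

theorem UnimodularFillsShifted.unimodularFills_succ {s g : ℕ}
    (H : UnimodularFillsShifted R s g) : UnimodularFills R s (g + 1) := by
  intro N C _ _ _ _ hN v hv
  obtain ⟨b, β, hb, hN'⟩ := (hN.of_equiv_left (snocEquiv g)).exists_complement
  let j : LinearMap.ker β × (R × C) →ₗ[Rᵐᵒᵖ] N × C :=
    ((Submodule.subtype _).comp (LinearMap.fst _ _ _) + (rightSpan R b).comp
      ((LinearMap.fst _ _ _).comp (LinearMap.snd _ _ _))).prod
        ((LinearMap.snd _ _ _).comp (LinearMap.snd _ _ _))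
  let p : N × C →ₗ[Rᵐᵒᵖ] LinearMap.ker β × (R × C) :=
    ((kerProj β b hb).comp (LinearMap.fst _ _ _)).prod
      ((β.comp (LinearMap.fst _ _ _)).prod (LinearMap.snd _ _ _))
  have hpj : ∀ x, p (j x) = x := by
    rintro ⟨⟨x, hx⟩, r, c⟩
    have hx : β x = 0 := hx
    ext <;> simp [p, j, rightSpan_apply, coe_kerProj, hx, hb]
  have hjp : ∀ x, j (p x) = x := by
    rintro ⟨x, c⟩
    ext <;> simp [p, j, rightSpan_apply, coe_kerProj]
  have hsub : j '' {q | q.2 = 0 ∨ q.2 = (1, 0)} ⊆ {q : N × C | q.2 = 0} := by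
    rintro _ ⟨⟨x, r, c⟩, hx, rfl⟩
    rcases hx with hx | hx <;> simpa [j] using congrArg Prod.snd hx
  refine PosetFills.unimodularWords_of_subset hsub hv fun u hu => ?_
  refine PosetFills.unimodularWords_image (v' := (u ++ v).map p)
    (Function.LeftInverse.injective hpj) (fun w _ => ?_) ?_
  · rw [← isUnimodularList_map_iff hpj, List.map_append (f := j), List.map_map]
    rw [show (u ++ v).map (j ∘ p) = u ++ v from List.map_id'' hjp _]
  · refine PosetFills.mono (H _ _ (1, 0) (LinearMap.fst _ _ _) rfl hN' _
      ((isUnimodularList_map_iff hjp).2 hu)) ?_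
    simp
    omega

theorem UnimodularFills.shifted_nil [Nontrivial R] {s g : ℕ} (H : UnimodularFills R s g)
    {e : C} {ε : C →ₗ[Rᵐᵒᵖ] R} (he : ε e = 1) (hN : IsSummand R (Fin g → R) N) :
    PosetFills (unimodularWords R {p : N × C | p.2 = 0 ∨ p.2 = e} []) ((g : ℤ) - s) := by
  have he0 : e ≠ 0 := by
    rintro rfl
    simp at he
  have hsub : {p : N × C | p.2 = 0} ⊆ {p : N × C | p.2 = 0 ∨ p.2 = e} := fun _ => Or.inl
  have hεe : ∀ n : N, ε.comp (LinearMap.snd _ _ _) (n, e) = 1 := fun _ => he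
  refine PosetFills.of_seqIn_cone (X := {p : N × C | p.2 = 0}) (y := (0, e))
    (chainCondition_unimodularWords _ _) he0 ⟨?_, ?_⟩ ?_ ?_
  · simp [OSeq.singleton]
  · exact isUnimodularList_singleton _ (hεe 0)
  · rintro w ⟨⟨-, hw⟩, hwX⟩
    have hUL : IsUnimodularList R (w.1 ++ [(0, e)]) := by
      obtain ⟨p, hpv, hdec, hpj⟩ := exists_proj_ker_snd he (0 : N)
      rw [isUnimodularList_append_cons_iff (hεe 0) hpv hdec, List.append_nil,
        ← isUnimodularList_map_iff hpj, List.map_map]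
      rw [List.append_nil] at hw
      convert hw
      refine (List.map_congr_left fun x hx => ?_).trans (List.map_id _)
      have hx0 : x.2 = 0 := hwX x hx
      conv_rhs => rw [id_eq, hdec x]
      simp [hx0]
    refine ⟨⟨by simp, hUL.1⟩, ?_, by simpa [OSeq.of] using hUL⟩
    intro x hx
    rcases List.mem_append.1 hx with hx | hx
    · exact Or.inl (hwX x hx)
    · rw [List.mem_singleton.1 hx]
      exact Or.inr rfl
  · intro u hu hhead
    rw [prefixWords_unimodularWords hsub hu.1, List.append_nil]
    obtain ⟨huX, hUL⟩ := hu
    obtain ⟨_ | ⟨⟨n, e'⟩, t⟩, hne, hnd⟩ := u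
    · exact absurd rfl hne
    obtain rfl : e' = e := (huX _ List.mem_cons_self).resolve_left (hhead (n, e') rfl)
    obtain ⟨p, hpv, hdec, hpj⟩ := exists_proj_ker_snd he n
    have himage : LinearMap.prodMap LinearMap.id (Submodule.subtype _) ''
        {q : N × LinearMap.ker ε | q.2 = 0} = {q : N × C | q.2 = 0} := by
      ext ⟨x, c⟩
      constructor
      · rintro ⟨⟨x', c'⟩, hc, h⟩
        obtain rfl : c' = 0 := hc
        exact (congrArg Prod.snd h).symm
      · rintro rfl
        exact ⟨(x, 0), rfl, rfl⟩
    rw [← himage]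
    refine PosetFills.unimodularWords_split (u := []) (hεe n) hpv hdec hpj ?_
    refine (H N (LinearMap.ker ε) hN _ ?_).mono ?_
    · rw [List.append_nil] at hUL
      exact (isUnimodularList_append_cons_iff (l := []) (hεe n) hpv hdec).1 hUL
    · simp
      omega

theorem SatisfiesStableRange.shifted_singleton [Nontrivial R] {s : ℕ}
    (hs : SatisfiesStableRange R s) {e : C} {ε : C →ₗ[Rᵐᵒᵖ] R} (he : ε e = 1)
    (hN : IsSummand R (Fin s → R) N) {v : N × C} (hv : IsUnimodularList R [v]) {D : ℤ}
    (hD : D ≤ -1) :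
    PosetFills (unimodularWords R {p : N × C | p.2 = 0 ∨ p.2 = e} [v]) D := by
  obtain ⟨φ, hφ, -⟩ := hv.2 v List.mem_cons_self
  obtain ⟨n, c⟩ := v
  obtain ⟨ι, π, hι⟩ := hN
  obtain ⟨h, π', γ, -, hγ⟩ := hs.stableRangeFor.exists_shear hι hφ
  obtain ⟨p, hpv, hdec, hpj⟩ := exists_proj_ker_snd he (-h e)
  have hαv : ε.comp (LinearMap.snd _ _ _) (-h e, e) = 1 := he
  have hUL : IsUnimodularList R [(-h e, e), (n, c)] := by
    rw [isUnimodularList_cons_iff hαv hpv hdec]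
    refine isUnimodularList_singleton ((γ.comp (π'.comp (LinearMap.fst _ _ _ +
      h.comp (LinearMap.snd _ _ _)))).comp
        (LinearMap.prodMap LinearMap.id (Submodule.subtype _))) ?_
    rw [LinearMap.comp_apply, ← sub_eq_of_eq_add (hdec (n, c))]
    refine Eq.trans ?_ hγ
    simp
  exact PosetFills.of_nonempty
    ⟨⟨OSeq.singleton (-h e, e), by simp [OSeq.singleton], hUL⟩⟩ hD

theorem UnimodularFillsShifted.cons_succ [Nontrivial R] {s g : ℕ}
    (hs : SatisfiesStableRange R s) (hsg : s ≤ g) (H : UnimodularFillsShifted R s g)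
    {e : C} {ε : C →ₗ[Rᵐᵒᵖ] R} (he : ε e = 1) (hN : IsSummand R (Fin (g + 1) → R) N)
    {v : N × C} {t : List (N × C)} (hv : IsUnimodularList R (v :: t)) :
    PosetFills (unimodularWords R {p : N × C | p.2 = 0 ∨ p.2 = e} (v :: t))
      ((g : ℤ) - s - t.length) := by
  obtain ⟨φ, hφ, -⟩ := hv.2 v List.mem_cons_self
  obtain ⟨n, c⟩ := v
  obtain ⟨ι, π, hι⟩ := hN.of_equiv_left (snocEquiv g)
  have hg := hs.stableRangeFor_of_le hsg
  obtain ⟨h, π', γ, hι', hγ⟩ := hg.prod.exists_shear hι hφ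
  obtain ⟨β, hβ, hN'⟩ := hg.exists_complement hι' hγ
  obtain ⟨p, j, α, hαv, hpv, hdec, hpj, hj⟩ := exists_proj_ker_fst hβ
  have hsub : j '' {q | q.2 = 0 ∨ q.2 = e} ⊆ {q : N × C | q.2 = 0 ∨ q.2 = e} := by
    rintro _ ⟨x, hx, rfl⟩
    change (j x).2 = 0 ∨ (j x).2 = e
    rwa [hj]
  refine PosetFills.unimodularWords_of_subset hsub hv fun u hu => ?_
  refine PosetFills.unimodularWords_split hαv hpv hdec hpj ?_
  refine (H _ _ e ε he hN' _ ((isUnimodularList_append_cons_iff hαv hpv hdec).1 hu)).mono ?_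
  simp
  omega

theorem SatisfiesStableRange.unimodularFills [Nontrivial R] {s : ℕ}
    (hs : SatisfiesStableRange R s) (g : ℕ) :
    UnimodularFills R s g ∧ UnimodularFillsShifted R s g := by
  have hs0 : s ≠ 0 := hs.ne_zero
  induction g with
  | zero =>
    have hbase : UnimodularFills R s 0 := fun N C _ _ _ _ hN v hv =>
      PosetFills.of_lt (by push_cast; omega)
    refine ⟨hbase, fun N C _ _ _ _ e ε he hN v hv => ?_⟩
    rcases v with - | ⟨v, t⟩
    · simpa using hbase.shifted_nil he hN
    · exact PosetFills.of_lt (by push_cast [List.length_cons]; omega)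
  | succ g ih =>
    have hbase := ih.2.unimodularFills_succ
    refine ⟨hbase, fun N C _ _ _ _ e ε he hN v hv => ?_⟩
    rcases v with - | ⟨v, t⟩
    · simpa using hbase.shifted_nil he hN
    · rcases lt_trichotomy (g + 1) s with hlt | rfl | hlt
      · exact PosetFills.of_lt (by push_cast [List.length_cons]; omega)
      · rcases t with - | ⟨v', t⟩
        · exact hs.shifted_singleton he hN hv (by simp)
        · exact PosetFills.of_lt (by push_cast [List.length_cons]; omega)
      · refine (ih.2.cons_succ hs (by omega) he hN hv).mono ?_
        push_cast [List.length_cons]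
        omega

end Connectivity

theorem seqIn_inter_unimodSeqs {R W : Type} [Ring R] [AddCommGroup W] [Module Rᵐᵒᵖ W]
    (X : Set W) : SeqIn X ∩ UnimodSeqs R W = unimodularWords R X [] := by
  ext w
  change (w ∈ SeqIn X ∧ IsUnimodularSeq R W (fun i : Fin w.1.length => w.1.get i)) ↔
    (w ∈ SeqIn X ∧ IsUnimodularList R (w.1 ++ []))
  rw [isUnimodularSeq_get_iff w.2.2, List.append_nil]

theorem posetFills_unimodularWords_of_subsingleton {R W : Type} [Ring R] [Subsingleton R]
    [AddCommGroup W] [Module Rᵐᵒᵖ W] {X : Set W} (hX : 0 ∈ X) (D : ℤ) :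
    PosetFills (unimodularWords R X []) D := by
  have : Subsingleton W := Module.subsingleton Rᵐᵒᵖ W
  have hlen : ∀ w : OSeq W, w.1 = [0] := fun w => by
    obtain ⟨_ | ⟨x, _ | ⟨y, t⟩⟩, hne, hnd⟩ := w
    · exact absurd rfl hne
    · exact congrArg (fun z => [z]) (Subsingleton.elim x 0)
    · exact absurd (Subsingleton.elim x y ▸ List.mem_cons_self) (List.nodup_cons.1 hnd).1
  have hmem : OSeq.singleton 0 ∈ unimodularWords R X [] :=
    ⟨by simpa [OSeq.singleton] using hX, isUnimodularList_singleton 0 (Subsingleton.elim _ _)⟩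
  let q₀ : ↥(unimodularWords R X []) := ⟨_, hmem⟩
  let q₀ : ↥(unimodularWords R X []) := ⟨_, hmem⟩
  let q₀ : ↥(unimodularWords R X []) := ⟨_, hmem⟩
  exact PosetFills.of_comparable (q := q₀)
    (fun q => Or.inl (Subtype.ext (Subtype.ext (hlen q.1)) : q = q₀).le) D

/-- If `R` satisfies the stable range condition `(S_s)` and `R^g` is a
direct summand of `M`, then the poset `O(M) ∩ U(M^∞)` of sequences with entries in
`M ⊆ M^∞` that are unimodular in `M^∞` is `(g − s − 1)`-connected. -/
theorem unimodularComplex_connectivity (R : Type) [Ring R] (M : Type) [AddCommGroup M]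
    [Module Rᵐᵒᵖ M] (s g : ℕ) (hs : SatisfiesStableRange R s)
    (hg : ∃ (ι : (Fin g → R) →ₗ[Rᵐᵒᵖ] M) (π : M →ₗ[Rᵐᵒᵖ] (Fin g → R)),
      π.comp ι = LinearMap.id) :
    SetDConnected (SeqIn {p : MInf R M | p.2 = 0} ∩ UnimodSeqs R (MInf R M))
      ((g : ℤ) - s - 1) := by
  rw [seqIn_inter_unimodSeqs]
  refine PosetFills.posetDConnected ?_
  rcases subsingleton_or_nontrivial R with _ | _
  · have h0 : (0 : MInf R M) ∈ {p : MInf R M | p.2 = 0} := rfl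
    exact posetFills_unimodularWords_of_subsingleton h0 _
  · obtain ⟨ι, π, h⟩ := hg
    simpa using (hs.unimodularFills g).1 M (ℕ →₀ R) ⟨ι, π, LinearMap.congr_fun h⟩ []
      isUnimodularList_nil
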